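/- For every z in the upper half-plane ℍ, with x(z) = (x₁(z),...,x₆(z)) the vector of eta-multiplied theta constants of order 13: Φ₃₂(x(z)) = η(z)⁸·Δ(z)²·E₄(z), Φ₄₂(x(z)) = Δ(z)³·E₆(z), and Φ₄₄(x(z)) = η(z)⁸·Δ(z)³·E₄(z). -/

import Mathlib

noncomputable section

open Complex

def ζ : ℂ := Complex.exp (2 * Real.pi * Complex.I / 13)

def AA0 (v : Fin 6 → ℂ) : ℂ := v 0 * v 3 + v 1 * v 4 + v 2 * v 5
def AA1 (v : Fin 6 → ℂ) : ℂ := (v 0) ^ 2 - 2 * v 2 * v 3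
def AA2 (v : Fin 6 → ℂ) : ℂ := -(v 4) ^ 2 - 2 * v 1 * v 3
def AA3 (v : Fin 6 → ℂ) : ℂ := (v 1) ^ 2 - 2 * v 0 * v 4
def AA4 (v : Fin 6 → ℂ) : ℂ := (v 2) ^ 2 - 2 * v 1 * v 5
def AA5 (v : Fin 6 → ℂ) : ℂ := -(v 3) ^ 2 - 2 * v 0 * v 5
def AA6 (v : Fin 6 → ℂ) : ℂ := -(v 5) ^ 2 - 2 * v 2 * v 4

def DD0 (v : Fin 6 → ℂ) : ℂ := v 0 * v 1 * v 2
def DD1 (v : Fin 6 → ℂ) : ℂ := 2 * v 1 * (v 2) ^ 2 + (v 1) ^ 2 * v 5 - (v 3) ^ 2 * v 4 + v 0 * v 4 * v 5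
def DD2 (v : Fin 6 → ℂ) : ℂ := -(v 5) ^ 3 + (v 1) ^ 2 * v 3 - 2 * v 1 * (v 4) ^ 2 + v 0 * v 3 * v 4 + 3 * v 2 * v 4 * v 5
def DD3 (v : Fin 6 → ℂ) : ℂ := 2 * v 0 * (v 1) ^ 2 + (v 0) ^ 2 * v 4 - v 3 * (v 5) ^ 2 + v 2 * v 3 * v 4
def DD4 (v : Fin 6 → ℂ) : ℂ := -(v 1) ^ 2 * v 2 + v 0 * (v 5) ^ 2 - 2 * (v 3) ^ 2 * v 5 - v 0 * v 2 * v 4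
def DD5 (v : Fin 6 → ℂ) : ℂ := -(v 3) ^ 3 + (v 2) ^ 2 * v 4 - 2 * v 2 * (v 5) ^ 2 + v 1 * v 4 * v 5 + 3 * v 0 * v 3 * v 5
def DD6 (v : Fin 6 → ℂ) : ℂ := -(v 4) ^ 3 + (v 0) ^ 2 * v 5 - 2 * v 0 * (v 3) ^ 2 + v 2 * v 3 * v 5 + 3 * v 1 * v 3 * v 4
def DD7 (v : Fin 6 → ℂ) : ℂ := -(v 1) ^ 3 + v 2 * (v 3) ^ 2 - v 0 * v 2 * v 5 - 3 * v 0 * v 1 * v 4 + 2 * (v 0) ^ 2 * v 3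
def DD8 (v : Fin 6 → ℂ) : ℂ := -(v 0) ^ 3 + v 1 * (v 5) ^ 2 - v 1 * v 2 * v 4 - 3 * v 0 * v 2 * v 3 + 2 * (v 2) ^ 2 * v 5
def DD9 (v : Fin 6 → ℂ) : ℂ := 2 * (v 0) ^ 2 * v 2 + (v 2) ^ 2 * v 3 - (v 4) ^ 2 * v 5 + v 1 * v 3 * v 5
def DD10 (v : Fin 6 → ℂ) : ℂ := -(v 0) * (v 2) ^ 2 + v 1 * (v 3) ^ 2 - 2 * v 3 * (v 4) ^ 2 - v 0 * v 1 * v 5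
def DD11 (v : Fin 6 → ℂ) : ℂ := -(v 2) ^ 3 + v 0 * (v 4) ^ 2 - v 0 * v 1 * v 3 - 3 * v 1 * v 2 * v 5 + 2 * (v 1) ^ 2 * v 4
def DD12 (v : Fin 6 → ℂ) : ℂ := -(v 0) ^ 2 * v 1 + v 2 * (v 4) ^ 2 - 2 * v 4 * (v 5) ^ 2 - v 1 * v 2 * v 3
def DDinf (v : Fin 6 → ℂ) : ℂ := v 3 * v 4 * v 5

def GG0 (v : Fin 6 → ℂ) : ℂ := (DD0 v) ^ 2 + (DDinf v) ^ 2
def GG1 (v : Fin 6 → ℂ) : ℂ := -(DD7 v) ^ 2 + 2 * DD0 v * DD1 v + 10 * DDinf v * DD1 v + 2 * DD2 v * DD12 v - 2 * DD3 v * DD11 v - 4 * DD4 v * DD10 v - 2 * DD9 v * DD5 v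
def GG2 (v : Fin 6 → ℂ) : ℂ := -2 * (DD1 v) ^ 2 - 4 * DD0 v * DD2 v + 6 * DDinf v * DD2 v - 2 * DD4 v * DD11 v + 2 * DD5 v * DD10 v - 2 * DD6 v * DD9 v - 2 * DD7 v * DD8 v
def GG3 (v : Fin 6 → ℂ) : ℂ := -(DD8 v) ^ 2 + 2 * DD0 v * DD3 v + 10 * DDinf v * DD3 v + 2 * DD6 v * DD10 v - 2 * DD9 v * DD7 v - 4 * DD12 v * DD4 v - 2 * DD1 v * DD2 v
def GG4 (v : Fin 6 → ℂ) : ℂ := -(DD2 v) ^ 2 + 10 * DD0 v * DD4 v - 2 * DDinf v * DD4 v + 2 * DD5 v * DD12 v - 2 * DD9 v * DD8 v - 4 * DD1 v * DD3 v - 2 * DD10 v * DD7 v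
def GG5 (v : Fin 6 → ℂ) : ℂ := -2 * (DD9 v) ^ 2 - 4 * DD0 v * DD5 v + 6 * DDinf v * DD5 v - 2 * DD10 v * DD8 v + 2 * DD6 v * DD12 v - 2 * DD2 v * DD3 v - 2 * DD11 v * DD7 v
def GG6 (v : Fin 6 → ℂ) : ℂ := -2 * (DD3 v) ^ 2 - 4 * DD0 v * DD6 v + 6 * DDinf v * DD6 v - 2 * DD12 v * DD7 v + 2 * DD2 v * DD4 v - 2 * DD5 v * DD1 v - 2 * DD8 v * DD11 v
def GG7 (v : Fin 6 → ℂ) : ℂ := -2 * (DD10 v) ^ 2 + 6 * DD0 v * DD7 v + 4 * DDinf v * DD7 v - 2 * DD1 v * DD6 v - 2 * DD2 v * DD5 v - 2 * DD8 v * DD12 v - 2 * DD9 v * DD11 v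
def GG8 (v : Fin 6 → ℂ) : ℂ := -2 * (DD4 v) ^ 2 + 6 * DD0 v * DD8 v + 4 * DDinf v * DD8 v - 2 * DD3 v * DD5 v - 2 * DD6 v * DD2 v - 2 * DD11 v * DD10 v - 2 * DD1 v * DD7 v
def GG9 (v : Fin 6 → ℂ) : ℂ := -(DD11 v) ^ 2 + 2 * DD0 v * DD9 v + 10 * DDinf v * DD9 v + 2 * DD5 v * DD4 v - 2 * DD1 v * DD8 v - 4 * DD10 v * DD12 v - 2 * DD3 v * DD6 v
def GG10 (v : Fin 6 → ℂ) : ℂ := -(DD5 v) ^ 2 + 10 * DD0 v * DD10 v - 2 * DDinf v * DD10 v + 2 * DD6 v * DD4 v - 2 * DD3 v * DD7 v - 4 * DD9 v * DD1 v - 2 * DD12 v * DD11 v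
def GG11 (v : Fin 6 → ℂ) : ℂ := -2 * (DD12 v) ^ 2 + 6 * DD0 v * DD11 v + 4 * DDinf v * DD11 v - 2 * DD9 v * DD2 v - 2 * DD5 v * DD6 v - 2 * DD7 v * DD4 v - 2 * DD3 v * DD8 v
def GG12 (v : Fin 6 → ℂ) : ℂ := -(DD6 v) ^ 2 + 10 * DD0 v * DD12 v - 2 * DDinf v * DD12 v + 2 * DD2 v * DD10 v - 2 * DD1 v * DD11 v - 4 * DD3 v * DD9 v - 2 * DD4 v * DD8 v

def wInf (v : Fin 6 → ℂ) : ℂ := 13 * (AA0 v) ^ 2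
def wF (ν : ℕ) (v : Fin 6 → ℂ) : ℂ :=
  (AA0 v + ζ ^ ν * AA1 v + ζ ^ (4 * ν) * AA2 v + ζ ^ (9 * ν) * AA3 v + ζ ^ (3 * ν) * AA4 v
    + ζ ^ (12 * ν) * AA5 v + ζ ^ (10 * ν) * AA6 v) ^ 2
def dInf (v : Fin 6 → ℂ) : ℂ := 13 ^ 2 * GG0 v
def dF (ν : ℕ) (v : Fin 6 → ℂ) : ℂ :=
  -13 * GG0 v + ζ ^ ν * GG1 v + ζ ^ (2 * ν) * GG2 v + ζ ^ (3 * ν) * GG3 v + ζ ^ (4 * ν) * GG4 v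
    + ζ ^ (5 * ν) * GG5 v + ζ ^ (6 * ν) * GG6 v + ζ ^ (7 * ν) * GG7 v + ζ ^ (8 * ν) * GG8 v
    + ζ ^ (9 * ν) * GG9 v + ζ ^ (10 * ν) * GG10 v + ζ ^ (11 * ν) * GG11 v + ζ ^ (12 * ν) * GG12 v

def Phi12 (v : Fin 6 → ℂ) : ℂ :=
  -(1 / (13 * 52) : ℂ) * ((∑ ν ∈ Finset.range 13, (dF ν v) ^ 2) + (dInf v) ^ 2)
def Phi18 (v : Fin 6 → ℂ) : ℂ :=
  (1 / (13 * 6) : ℂ) * ((∑ ν ∈ Finset.range 13, (dF ν v) ^ 3) + (dInf v) ^ 3)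
def Phi30 (v : Fin 6 → ℂ) : ℂ :=
  -(1 / (13 * 1315) : ℂ) * ((∑ ν ∈ Finset.range 13, (dF ν v) ^ 5) + (dInf v) ^ 5)
def Phi42 (v : Fin 6 → ℂ) : ℂ :=
  (1 / (13 * 226842) : ℂ) * ((∑ ν ∈ Finset.range 13, (dF ν v) ^ 7) + (dInf v) ^ 7)

def Phi20 (v : Fin 6 → ℂ) : ℂ :=
  (1 / (13 * 25) : ℂ) * ((∑ ν ∈ Finset.range 13, (wF ν v) ^ 5) + (wInf v) ^ 5)
def Phi32 (v : Fin 6 → ℂ) : ℂ :=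
  -(1 / (13 * 1840) : ℂ) * ((∑ ν ∈ Finset.range 13, (wF ν v) ^ 8) + (wInf v) ^ 8)
def Phi44 (v : Fin 6 → ℂ) : ℂ :=
  (1 / (13 * 146905) : ℂ) * ((∑ ν ∈ Finset.range 13, (wF ν v) ^ 11) + (wInf v) ^ 11)

def th13 (c : ℚ) (k : ℤ) (z : ℂ) : ℂ :=
  Complex.exp (2 * Real.pi * Complex.I * (c : ℂ) * z) *
    ∑' n : ℤ, (-1 : ℂ) ^ n *
      Complex.exp (2 * Real.pi * Complex.I * (((13 * n ^ 2 + k * n : ℤ) : ℂ) / 2) * z)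

def ta : Fin 6 → ℂ → ℂ :=
  ![th13 (121 / 104) 11, th13 (49 / 104) 7, th13 (25 / 104) 5,
    fun z => -th13 (9 / 104) 3 z, th13 (81 / 104) 9, th13 (1 / 104) 1]

def AV (z : ℂ) : Fin 6 → ℂ := fun i => ta i z

def etaF (z : ℂ) : ℂ :=
  Complex.exp (2 * Real.pi * Complex.I * z / 24) *
    ∏' n : ℕ, (1 - Complex.exp (2 * Real.pi * Complex.I * z) ^ (n + 1))

def xV (z : ℂ) : Fin 6 → ℂ := fun i => etaF z * ta i z

def Δfun (z : ℂ) : ℂ := (etaF z) ^ 24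

def Eis (k : ℕ) (z : ℂ) : ℂ :=
  (1 / 2 : ℂ) * ∑' p : {p : ℤ × ℤ // Int.gcd p.1 p.2 = 1},
    1 / ((p.val.1 : ℂ) * z + (p.val.2 : ℂ)) ^ k

/-! ### The Weil representation on functions on `ZMod 13` -/

/-- The standard additive character of `ZMod 13`. -/
abbrev chi (a : ZMod 13) : ℂ := ZMod.stdAddChar a

theorem chi_add (a b : ZMod 13) : chi (a + b) = chi a * chi b := AddChar.map_add_eq_mul _ a b

theorem chi_one : chi 1 = ζ := by
  have h := ZMod.stdAddChar_coe (N := 13) 1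
  rw [Int.cast_one] at h
  rw [chi, h, ζ]
  congr 1
  push_cast
  ring

theorem chi_natCast (n : ℕ) : chi (n : ZMod 13) = ζ ^ n := by
  rw [← chi_one, chi, chi, ← AddChar.map_nsmul_eq_pow, nsmul_one]

theorem zeta_pow_thirteen : ζ ^ 13 = 1 := by
  rw [← chi_natCast, show ((13 : ℕ) : ZMod 13) = 0 from rfl]
  exact AddChar.map_zero_eq_one _

theorem sum_chi_mul (a : ZMod 13) : ∑ s, chi (s * a) = if a = 0 then 13 else 0 := by
  have h := AddChar.sum_mulShift a (ZMod.isPrimitive_stdAddChar 13)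
  rw [ZMod.card] at h
  exact_mod_cast h

/-- The discrete Fourier transform. -/
def dft13 (g : ZMod 13 → ℂ) (t : ZMod 13) : ℂ := ∑ s, chi (s * t) * g s

/-- Multiplication by the Gaussian of parameter `c`. -/
def twist (c : ZMod 13) (g : ZMod 13 → ℂ) (t : ZMod 13) : ℂ := chi (7 * c * t ^ 2) * g t

def dilate (u : ZMod 13) (g : ZMod 13 → ℂ) (t : ZMod 13) : ℂ := g (u * t)

/-- The quadratic Gauss sum. -/
def quadGauss (c : ZMod 13) : ℂ := ∑ s, chi (7 * c * s ^ 2)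

theorem odd_dft {g : ZMod 13 → ℂ} (hg : g.Odd) : (dft13 g).Odd := fun t => by
  rw [dft13, dft13, ← Equiv.sum_comp (Equiv.neg (ZMod 13)), ← Finset.sum_neg_distrib]
  refine Finset.sum_congr rfl fun s _ => ?_
  simp only [Equiv.neg_apply, hg s, mul_neg, neg_mul, neg_neg]

theorem odd_twist {g : ZMod 13 → ℂ} (hg : g.Odd) (c : ZMod 13) : (twist c g).Odd :=
  fun t => by simp only [twist, hg t, mul_neg, neg_sq]

theorem odd_dilate {g : ZMod 13 → ℂ} (hg : g.Odd) (c : ZMod 13) : (dilate c g).Odd :=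
  fun t => by simp only [dilate, mul_neg, hg _]

theorem dft_dft (g : ZMod 13 → ℂ) (t : ZMod 13) :
    dft13 (dft13 g) t = 13 * g (-t) := by
  simp only [dft13, Finset.mul_sum]
  rw [Finset.sum_comm]
  have h (r : ZMod 13) : ∑ s, chi (s * t) * (chi (r * s) * g r)
      = if r = -t then 13 * g r else 0 := by
    simp_rw [← mul_assoc, ← chi_add, ← Finset.sum_mul, mul_comm r, ← mul_add, sum_chi_mul,
      ite_mul, zero_mul, add_comm t, ← eq_neg_iff_add_eq_zero]
  simp [h]

theorem twist_twist (b c : ZMod 13) (g : ZMod 13 → ℂ) :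
    twist b (twist c g) = twist (b + c) g := by
  ext t
  rw [twist, twist, twist, ← mul_assoc, ← chi_add]
  ring_nf

theorem twist_zero (g : ZMod 13 → ℂ) : twist 0 g = g := by
  ext t
  simp [twist, chi]

theorem sum_chi_quadratic {c : ZMod 13} (hc : c ≠ 0) (x : ZMod 13) :
    ∑ s, chi (7 * c * s ^ 2 + s * x) = quadGauss c * chi (7 * -c⁻¹ * x ^ 2) := by
  have : Fact (Nat.Prime 13) := ⟨by norm_num⟩
  rw [quadGauss, Finset.sum_mul, ← Equiv.sum_comp (Equiv.addRight (c⁻¹ * x))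
    fun s => chi (7 * c * s ^ 2) * chi (7 * -c⁻¹ * x ^ 2)]
  refine Finset.sum_congr rfl fun s _ => ?_
  rw [← chi_add, Equiv.coe_addRight]
  congr 1
  have h13 : (13 : ZMod 13) = 0 := rfl
  have hcc : c * c⁻¹ = 1 := mul_inv_cancel₀ hc
  linear_combination (-14 * s * x - 7 * c⁻¹ * x ^ 2) * hcc - s * x * h13

theorem dft_twist_dft {c : ZMod 13} (hc : c ≠ 0) (g : ZMod 13 → ℂ) :
    dft13 (twist c (dft13 g))
      = quadGauss c • twist (-c⁻¹) (dilate (-c⁻¹) (dft13 (twist (-c⁻¹) g))) := by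
  ext t
  simp only [dft13, twist, dilate, Pi.smul_apply, smul_eq_mul, Finset.mul_sum]
  rw [Finset.sum_comm]
  refine Finset.sum_congr rfl fun r _ => ?_
  have h (s : ZMod 13) : chi (s * t) * (chi (7 * c * s ^ 2) * (chi (r * s) * g r))
      = chi (7 * c * s ^ 2 + s * (t + r)) * g r := by
    rw [show 7 * c * s ^ 2 + s * (t + r) = s * t + (7 * c * s ^ 2 + r * s) by ring,
      chi_add, chi_add]
    ring
  simp_rw [h, ← Finset.sum_mul, sum_chi_quadratic hc]
  have h13 : (13 : ZMod 13) = 0 := rfl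
  rw [show 7 * -c⁻¹ * (t + r) ^ 2
      = 7 * -c⁻¹ * t ^ 2 + (r * (-c⁻¹ * t) + 7 * -c⁻¹ * r ^ 2) by
    linear_combination -(c⁻¹ * t * r) * h13, chi_add, chi_add]
  ring

theorem quadGauss_sq {c : ZMod 13} (hc : c ≠ 0) : quadGauss c ^ 2 = 13 := by
  have h50 : (5 : ZMod 13) ≠ 0 := by decide
  have : Fact (Nat.Prime 13) := ⟨by norm_num⟩
  have h13 : (13 : ZMod 13) = 0 := rfl
  have h (s t : ZMod 13) : chi (7 * c * s ^ 2) * chi (7 * c * (t + 5 * s) ^ 2)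
      = chi (7 * c * t ^ 2) * chi (s * (5 * c * t)) := by
    rw [← chi_add, ← chi_add]
    congr 1
    linear_combination (14 * c * s ^ 2 + 5 * c * s * t) * h13
  have h5 (t : ZMod 13) : 5 * c * t = 0 ↔ t = 0 := by
    rw [mul_eq_zero, or_iff_right (mul_ne_zero h50 hc)]
  calc quadGauss c ^ 2
      = ∑ s, ∑ t, chi (7 * c * s ^ 2) * chi (7 * c * (t + 5 * s) ^ 2) := by
        rw [sq, quadGauss, Finset.sum_mul_sum]
        exact Finset.sum_congr rfl fun s _ => (Equiv.sum_comp (Equiv.addRight (5 * s))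
          fun t => chi (7 * c * s ^ 2) * chi (7 * c * t ^ 2)).symm
    _ = 13 := by
        simp_rw [h]
        rw [Finset.sum_comm]
        simp [← Finset.mul_sum, sum_chi_mul, h5, chi]

/-! ### Power sums over the orbit of an invariant form -/

/-- A function on odd functions on `ZMod 13`, homogeneous of degree `2 * m` and invariant under
Gaussian twists and dilations. -/
structure IsBorelInvariant (m : ℕ) (Q : (ZMod 13 → ℂ) → ℂ) : Prop where
  map_smul : ∀ (c : ℂ) (g : ZMod 13 → ℂ), Q (c • g) = c ^ (2 * m) * Q g
  map_twist : ∀ (c : ZMod 13) (g : ZMod 13 → ℂ), g.Odd → Q (twist c g) = Q g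
  map_dilate : ∀ u : ZMod 13, u ≠ 0 → ∀ g : ZMod 13 → ℂ, g.Odd → Q (dilate u g) = Q g

/-- The power sum of order `N` over the fourteen conjugates of `Q`. -/
def orbitSum (m : ℕ) (Q : (ZMod 13 → ℂ) → ℂ) (N : ℕ) (g : ZMod 13 → ℂ) : ℂ :=
  ∑ ν, Q (dft13 (twist ν g)) ^ N + (13 ^ m * Q g) ^ N

namespace IsBorelInvariant

variable {m : ℕ} {Q : (ZMod 13 → ℂ) → ℂ}

theorem map_dft_twist_dft (hQ : IsBorelInvariant m Q) {c : ZMod 13} (hc : c ≠ 0)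
    {g : ZMod 13 → ℂ} (hg : g.Odd) :
    Q (dft13 (twist c (dft13 g)))
      = 13 ^ m * Q (dft13 (twist (-c⁻¹) g)) := by
  have : Fact (Nat.Prime 13) := ⟨by norm_num⟩
  have hodd := odd_dft (odd_twist hg (-c⁻¹))
  rw [dft_twist_dft hc, hQ.map_smul, hQ.map_twist _ _ (odd_dilate hodd _),
    hQ.map_dilate _ (neg_ne_zero.mpr (inv_ne_zero hc)) _ hodd, pow_mul, quadGauss_sq hc]

theorem map_dft_dft (hQ : IsBorelInvariant m Q) {g : ZMod 13 → ℂ} (hg : g.Odd) :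
    Q (dft13 (dft13 g)) = 13 ^ m * (13 ^ m * Q g) := by
  have h : dft13 (dft13 g) = (-13 : ℂ) • g := by
    ext t
    rw [dft_dft, hg t, Pi.smul_apply, smul_eq_mul]
    ring
  rw [h, hQ.map_smul, pow_mul, ← mul_assoc, ← mul_pow]
  norm_num

theorem orbitSum_dft (hQ : IsBorelInvariant m Q) (N : ℕ) {g : ZMod 13 → ℂ} (hg : g.Odd) :
    orbitSum m Q N (dft13 g) = 13 ^ (m * N) * orbitSum m Q N g := by
  have : Fact (Nat.Prime 13) := ⟨by norm_num⟩
  let e : ZMod 13 ≃ ZMod 13 :=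
    ⟨fun c => -c⁻¹, fun c => -c⁻¹, fun c => by simp [inv_neg], fun c => by simp [inv_neg]⟩
  have h : ∑ ν ∈ {0}ᶜ, Q (dft13 (twist ν (dft13 g))) ^ N
      = 13 ^ (m * N) * ∑ ν ∈ {0}ᶜ, Q (dft13 (twist ν g)) ^ N := by
    rw [Finset.mul_sum]
    refine Finset.sum_equiv e (fun c => by simp [e]) fun c hc => ?_
    rw [hQ.map_dft_twist_dft (by simpa using hc) hg, mul_pow, pow_mul]
    rfl
  rw [orbitSum, orbitSum, Fintype.sum_eq_add_sum_compl 0, Fintype.sum_eq_add_sum_compl 0, h]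
  simp only [twist_zero, hQ.map_dft_dft hg]
  rw [mul_pow (13 ^ m), mul_pow (13 ^ m), ← pow_mul]
  ring

theorem orbitSum_smul (hQ : IsBorelInvariant m Q) (N : ℕ) (c : ℂ) (g : ZMod 13 → ℂ) :
    orbitSum m Q N (c • g) = c ^ (2 * m * N) * orbitSum m Q N g := by
  have h (ν : ZMod 13) : dft13 (twist ν (c • g)) = c • dft13 (twist ν g) := by
    ext t
    simp only [dft13, twist, Pi.smul_apply, smul_eq_mul, Finset.mul_sum]
    exact Finset.sum_congr rfl fun s _ => by ring
  simp only [orbitSum, h, hQ.map_smul, mul_add, Finset.mul_sum, pow_mul, mul_pow]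
  ring

theorem orbitSum_twist (hQ : IsBorelInvariant m Q) (N : ℕ) (c : ZMod 13) {g : ZMod 13 → ℂ}
    (hg : g.Odd) : orbitSum m Q N (twist c g) = orbitSum m Q N g := by
  simp only [orbitSum, twist_twist, hQ.map_twist c g hg]
  congr 1
  exact Equiv.sum_comp (Equiv.addRight c) fun ν => Q (dft13 (twist ν g)) ^ N

end IsBorelInvariant

/-! ### The forms `wF` and `dF` as orbits -/

/-- The six coordinates of an odd function on `ZMod 13`. -/
def oddVec (g : ZMod 13 → ℂ) : Fin 6 → ℂ := ![g 1, g 3, g 9, g 8, g 11, g 7]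

/-- The diagonal action of a thirteenth root of unity. -/
def diagAct (y : ℂ) (v : Fin 6 → ℂ) : Fin 6 → ℂ :=
  ![y ^ 7 * v 0, y ^ 11 * v 1, y ^ 8 * v 2, y ^ 6 * v 3, y ^ 2 * v 4, y ^ 5 * v 5]

theorem chi_nsmul (n : ℕ) (c : ZMod 13) : chi (n * c) = chi c ^ n := by
  rw [← nsmul_eq_mul]
  exact AddChar.map_nsmul_eq_pow _ _ _

theorem chi_pow_thirteen (c : ZMod 13) : chi c ^ 13 = 1 := by
  rw [← chi_nsmul, show ((13 : ℕ) : ZMod 13) = 0 from rfl, zero_mul]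
  exact AddChar.map_zero_eq_one _

theorem oddVec_twist (c : ZMod 13) (g : ZMod 13 → ℂ) :
    oddVec (twist c g) = diagAct (chi c) (oddVec g) := by
  have h (n : ℕ) (t : ZMod 13) (ht : 7 * t ^ 2 = n) : twist c g t = chi c ^ n * g t := by
    rw [twist, ← chi_nsmul, ← ht]
    ring_nf
  ext i
  fin_cases i <;> exact h _ _ rfl

theorem pow_reduce_thirteen {z : ℂ} (h : z ^ 13 = 1) (k : ℕ) (hk : 13 ≤ k) :
    z ^ k = z ^ (k - 13) := by
  rw [← Nat.sub_add_cancel hk, pow_add, h, mul_one, Nat.add_sub_cancel]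

theorem AA_diagAct {y : ℂ} (hy : y ^ 13 = 1) (v : Fin 6 → ℂ) :
    AA0 (diagAct y v) = AA0 v ∧ AA1 (diagAct y v) = y * AA1 v ∧
    AA2 (diagAct y v) = y ^ 4 * AA2 v ∧ AA3 (diagAct y v) = y ^ 9 * AA3 v ∧
    AA4 (diagAct y v) = y ^ 3 * AA4 v ∧ AA5 (diagAct y v) = y ^ 12 * AA5 v ∧
    AA6 (diagAct y v) = y ^ 10 * AA6 v := by
  refine ⟨?_, ?_, ?_, ?_, ?_, ?_, ?_⟩ <;>
  · simp only [AA0, AA1, AA2, AA3, AA4, AA5, AA6, diagAct, Matrix.cons_val]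
    ring_nf
    try simp only [pow_reduce_thirteen hy, Nat.reduceLeDiff, Nat.reduceSub]
    try ring

theorem DD_diagAct {y : ℂ} (hy : y ^ 13 = 1) (v : Fin 6 → ℂ) :
    DD0 (diagAct y v) = DD0 v ∧ DDinf (diagAct y v) = DDinf v ∧
    DD1 (diagAct y v) = y ^ 1 * DD1 v ∧ DD2 (diagAct y v) = y ^ 2 * DD2 v ∧
    DD3 (diagAct y v) = y ^ 3 * DD3 v ∧ DD4 (diagAct y v) = y ^ 4 * DD4 v ∧
    DD5 (diagAct y v) = y ^ 5 * DD5 v ∧ DD6 (diagAct y v) = y ^ 6 * DD6 v ∧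
    DD7 (diagAct y v) = y ^ 7 * DD7 v ∧ DD8 (diagAct y v) = y ^ 8 * DD8 v ∧
    DD9 (diagAct y v) = y ^ 9 * DD9 v ∧ DD10 (diagAct y v) = y ^ 10 * DD10 v ∧
    DD11 (diagAct y v) = y ^ 11 * DD11 v ∧ DD12 (diagAct y v) = y ^ 12 * DD12 v := by
  refine ⟨?_, ?_, ?_, ?_, ?_, ?_, ?_, ?_, ?_, ?_, ?_, ?_, ?_, ?_⟩ <;>
  · simp only [DD0, DD1, DD2, DD3, DD4, DD5, DD6, DD7, DD8, DD9, DD10, DD11, DD12, DDinf, diagAct,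
      Matrix.cons_val]
    ring_nf
    simp only [pow_reduce_thirteen hy, Nat.reduceLeDiff, Nat.reduceSub]
    try ring

theorem GG_diagAct {y : ℂ} (hy : y ^ 13 = 1) (v : Fin 6 → ℂ) :
    GG0 (diagAct y v) = GG0 v ∧
    GG1 (diagAct y v) = y ^ 1 * GG1 v ∧ GG2 (diagAct y v) = y ^ 2 * GG2 v ∧
    GG3 (diagAct y v) = y ^ 3 * GG3 v ∧ GG4 (diagAct y v) = y ^ 4 * GG4 v ∧
    GG5 (diagAct y v) = y ^ 5 * GG5 v ∧ GG6 (diagAct y v) = y ^ 6 * GG6 v ∧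
    GG7 (diagAct y v) = y ^ 7 * GG7 v ∧ GG8 (diagAct y v) = y ^ 8 * GG8 v ∧
    GG9 (diagAct y v) = y ^ 9 * GG9 v ∧ GG10 (diagAct y v) = y ^ 10 * GG10 v ∧
    GG11 (diagAct y v) = y ^ 11 * GG11 v ∧ GG12 (diagAct y v) = y ^ 12 * GG12 v := by
  obtain ⟨h0, hinf, h1, h2, h3, h4, h5, h6, h7, h8, h9, h10, h11, h12⟩ := DD_diagAct hy v
  refine ⟨by simp only [GG0, h0, hinf], ?_, ?_, ?_, ?_, ?_, ?_, ?_, ?_, ?_, ?_, ?_, ?_⟩ <;>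
  · simp only [GG1, GG2, GG3, GG4, GG5, GG6, GG7, GG8, GG9, GG10, GG11, GG12,
      h0, hinf, h1, h2, h3, h4, h5, h6, h7, h8, h9, h10, h11, h12]
    ring_nf
    try simp only [pow_reduce_thirteen hy, Nat.reduceLeDiff, Nat.reduceSub]
    try ring

theorem zeta_pow_pow (ν : ℕ) : (ζ ^ ν) ^ 13 = 1 := by
  rw [← pow_mul, mul_comm, pow_mul, zeta_pow_thirteen, one_pow]

theorem wF_eq_wF_zero (ν : ℕ) (v : Fin 6 → ℂ) : wF ν v = wF 0 (diagAct (ζ ^ ν) v) := by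
  obtain ⟨h0, h1, h2, h3, h4, h5, h6⟩ := AA_diagAct (zeta_pow_pow ν) v
  simp only [wF, h0, h1, h2, h3, h4, h5, h6]
  ring

theorem dF_eq_dF_zero (ν : ℕ) (v : Fin 6 → ℂ) : dF ν v = dF 0 (diagAct (ζ ^ ν) v) := by
  obtain ⟨h0, h1, h2, h3, h4, h5, h6, h7, h8, h9, h10, h11, h12⟩ :=
    GG_diagAct (zeta_pow_pow ν) v
  simp only [dF, h0, h1, h2, h3, h4, h5, h6, h7, h8, h9, h10, h11, h12]
  ring

theorem sum_zmod_thirteen (f : ZMod 13 → ℂ) : ∑ s, f s = ∑ n ∈ Finset.range 13, f n := by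
  rw [Finset.sum_range]
  exact Finset.sum_congr rfl fun s _ => congrArg f (ZMod.natCast_zmod_val s).symm

theorem sum_zeta_pow : ∑ n ∈ Finset.range 13, ζ ^ n = 0 := by
  have h := sum_chi_mul 1
  rw [sum_zmod_thirteen, if_neg (by decide)] at h
  simpa only [mul_one, chi_natCast] using h

/-- The Fourier transform on the coordinates of odd functions. -/
def fourierAct (v : Fin 6 → ℂ) : Fin 6 → ℂ :=
  let a := v 0
  let b := v 1
  let c := v 2
  let d := v 3
  let e := v 4
  let f := v 5
  let z := ζ
  ![(z-z^12)*a + (z^3-z^10)*b + (z^9-z^4)*c + (z^8-z^5)*d + (z^11-z^2)*e + (z^7-z^6)*f,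
    (z^3-z^10)*a + (z^9-z^4)*b + (z-z^12)*c + (z^11-z^2)*d + (z^7-z^6)*e + (z^8-z^5)*f,
    (z^9-z^4)*a + (z-z^12)*b + (z^3-z^10)*c + (z^7-z^6)*d + (z^8-z^5)*e + (z^11-z^2)*f,
    (z^8-z^5)*a + (z^11-z^2)*b + (z^7-z^6)*c + (z^12-z)*d + (z^10-z^3)*e + (z^4-z^9)*f,
    (z^11-z^2)*a + (z^7-z^6)*b + (z^8-z^5)*c + (z^10-z^3)*d + (z^4-z^9)*e + (z^12-z)*f,
    (z^7-z^6)*a + (z^8-z^5)*b + (z^11-z^2)*c + (z^4-z^9)*d + (z^12-z)*e + (z^10-z^3)*f]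

theorem oddVec_dft {g : ZMod 13 → ℂ} (hg : g.Odd) :
    oddVec (dft13 g) = fourierAct (oddVec g) := by
  have h0 : g 0 = 0 := by simpa [self_eq_neg] using hg 0
  have hn (k l : ZMod 13) (hkl : k + l = 0) : g k = -g l := by
    rw [eq_neg_of_add_eq_zero_left hkl, hg]
  have h2 := hn 2 11 rfl
  have h4 := hn 4 9 rfl
  have h5 := hn 5 8 rfl
  have h6 := hn 6 7 rfl
  have h10 := hn 10 3 rfl
  have h12 := hn 12 1 rfl
  have key (k : ℕ) : dft13 g k = ∑ n ∈ Finset.range 13, ζ ^ (n * k) * g n := by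
    rw [dft13, sum_zmod_thirteen]
    refine Finset.sum_congr rfl fun n _ => ?_
    rw [← chi_natCast, Nat.cast_mul]
  have h (k : ℕ) (w : ℂ) (hw : ∑ n ∈ Finset.range 13, ζ ^ (n * k) * g n = w) :
      dft13 g k = w := (key k).trans hw
  rw [oddVec, show dft13 g 1 = _ from h 1 _ rfl, show dft13 g 3 = _ from h 3 _ rfl,
    show dft13 g 9 = _ from h 9 _ rfl, show dft13 g 8 = _ from h 8 _ rfl,
    show dft13 g 11 = _ from h 11 _ rfl, show dft13 g 7 = _ from h 7 _ rfl]
  simp only [Finset.sum_range_succ, Finset.sum_range_zero, Nat.cast_ofNat, Nat.cast_zero,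
    Nat.cast_one, h0, h2, h4, h5, h6, h10, h12, Nat.reduceMul,
    pow_reduce_thirteen zeta_pow_thirteen, Nat.reduceLeDiff, Nat.reduceSub, fourierAct, oddVec,
    Matrix.cons_val]
  ring_nf

set_option maxRecDepth 100000 in
theorem AA0_fourierAct (v : Fin 6 → ℂ) :
    AA0 (fourierAct v)
      = (ζ + ζ ^ 3 + ζ ^ 4 + ζ ^ 9 + ζ ^ 10 + ζ ^ 12 - ζ ^ 2 - ζ ^ 5 - ζ ^ 6 - ζ ^ 7 - ζ ^ 8 - ζ ^ 11)
        * (AA0 v + AA1 v + AA2 v + AA3 v + AA4 v + AA5 v + AA6 v) := by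
  simp only [AA0, AA1, AA2, AA3, AA4, AA5, AA6, fourierAct, Matrix.cons_val]
  rw [← sub_eq_zero]
  ring_nf
  simp only [pow_reduce_thirteen zeta_pow_thirteen, Nat.reduceLeDiff, Nat.reduceSub]
  ring

theorem wInf_fourierAct (v : Fin 6 → ℂ) : wInf (fourierAct v) = 13 ^ 2 * wF 0 v := by
  have h : (ζ + ζ ^ 3 + ζ ^ 4 + ζ ^ 9 + ζ ^ 10 + ζ ^ 12 - ζ ^ 2 - ζ ^ 5 - ζ ^ 6 - ζ ^ 7 - ζ ^ 8
      - ζ ^ 11) ^ 2 = 13 := by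
    have hs := sum_zeta_pow
    simp only [Finset.sum_range_succ, Finset.sum_range_zero] at hs
    ring_nf
    simp only [pow_reduce_thirteen zeta_pow_thirteen, Nat.reduceLeDiff, Nat.reduceSub]
    linear_combination -hs
  rw [wInf, wF, AA0_fourierAct, mul_pow, h]
  simp only [mul_zero, pow_zero, one_mul]
  ring

/-- The sum of sines over the cubic residues, entering the Fourier transform of `DD0`. -/
def sineSum₁ : ℂ := ζ + ζ ^ 3 + ζ ^ 9 - ζ ^ 12 - ζ ^ 10 - ζ ^ 4

/-- The companion of `sineSum₁` over twice the cubic residues. -/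
def sineSum₂ : ℂ := ζ ^ 2 + ζ ^ 6 + ζ ^ 5 - ζ ^ 11 - ζ ^ 7 - ζ ^ 8

theorem sineSum_sq_add_sq : sineSum₁ ^ 2 + sineSum₂ ^ 2 = -13 := by
  have hs := sum_zeta_pow
  simp only [Finset.sum_range_succ, Finset.sum_range_zero] at hs
  simp only [sineSum₁, sineSum₂]
  ring_nf
  simp only [pow_reduce_thirteen zeta_pow_thirteen, Nat.reduceLeDiff, Nat.reduceSub]
  linear_combination hs

set_option maxRecDepth 100000 in
theorem DD0_fourierAct (v : Fin 6 → ℂ) :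
    DD0 (fourierAct v)
      = (3 * sineSum₂ - 2 * sineSum₁) * DD0 v - sineSum₁ * (DD2 v + DD5 v + DD6 v)
        - sineSum₂ * (DD7 v + DD8 v + DD11 v)
        + (sineSum₁ - sineSum₂) * (DD4 v + DD10 v + DD12 v)
        - (sineSum₁ + sineSum₂) * (DD1 v + DD3 v + DD9 v)
        + (3 * sineSum₁ + 2 * sineSum₂) * DDinf v := by
  simp only [DD0, DD1, DD2, DD3, DD4, DD5, DD6, DD7, DD8, DD9, DD10, DD11, DD12, DDinf,
    fourierAct, sineSum₁, sineSum₂, Matrix.cons_val]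
  rw [← sub_eq_zero]
  ring_nf
  simp only [pow_reduce_thirteen zeta_pow_thirteen, Nat.reduceLeDiff, Nat.reduceSub]
  ring

theorem DDinf_fourierAct (v : Fin 6 → ℂ) :
    DDinf (fourierAct v)
      = (3 * sineSum₁ + 2 * sineSum₂) * DD0 v + (sineSum₂ - sineSum₁) * (DD1 v + DD3 v + DD9 v)
        + sineSum₂ * (DD2 v + DD5 v + DD6 v) - sineSum₁ * (DD7 v + DD8 v + DD11 v)
        - (sineSum₁ + sineSum₂) * (DD4 v + DD10 v + DD12 v)
        - (3 * sineSum₂ - 2 * sineSum₁) * DDinf v := by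
  have h := DD0_fourierAct ![v 3, v 4, v 5, -v 0, -v 1, -v 2]
  have hr : DDinf (fourierAct v) = -DD0 (fourierAct ![v 3, v 4, v 5, -v 0, -v 1, -v 2]) := by
    simp only [DD0, DDinf, fourierAct, Matrix.cons_val]
    ring
  rw [hr, h]
  simp only [DD0, DD1, DD2, DD3, DD4, DD5, DD6, DD7, DD8, DD9, DD10, DD11, DD12, DDinf,
    Matrix.cons_val]
  ring

theorem dInf_fourierAct (v : Fin 6 → ℂ) : dInf (fourierAct v) = 13 ^ 3 * dF 0 v := by
  rw [dInf, GG0, DD0_fourierAct, DDinf_fourierAct, dF]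
  simp only [mul_zero, pow_zero, one_mul]
  simp only [GG0, GG1, GG2, GG3, GG4, GG5, GG6, GG7, GG8, GG9, GG10, GG11, GG12]
  linear_combination 13 ^ 2 * ((-2 * DD0 v - (DD2 v + DD5 v + DD6 v) + (DD4 v + DD10 v + DD12 v)
    - (DD1 v + DD3 v + DD9 v) + 3 * DDinf v) ^ 2 + (3 * DD0 v - (DD7 v + DD8 v + DD11 v)
    - (DD4 v + DD10 v + DD12 v) - (DD1 v + DD3 v + DD9 v) + 2 * DDinf v) ^ 2) * sineSum_sq_add_sq

theorem isBorelInvariant_of_generators {m : ℕ} {Q : (Fin 6 → ℂ) → ℂ}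
    (hsmul : ∀ (c : ℂ) (v : Fin 6 → ℂ), Q (c • v) = c ^ (2 * m) * Q v)
    (hdiag : ∀ y : ℂ, y ^ 13 = 1 → ∀ v, Q (diagAct y v) = Q v)
    (hdilate : ∀ v, Q ![-v 4, -v 5, -v 3, v 1, v 2, v 0] = Q v) :
    IsBorelInvariant m (Q ∘ oddVec) where
  map_smul c g := by
    rw [Function.comp_apply, Function.comp_apply, ← hsmul]
    congr 1
    ext i
    fin_cases i <;> rfl
  map_twist c g _ := by
    rw [Function.comp_apply, oddVec_twist, hdiag _ (chi_pow_thirteen c), Function.comp_apply]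
  map_dilate := by
    have htwo (g : ZMod 13 → ℂ) (hg : g.Odd) : Q (oddVec (dilate 2 g)) = Q (oddVec g) := by
      have hn (k l : ZMod 13) (hkl : k + l = 0) : g k = -g l := by
        rw [eq_neg_of_add_eq_zero_left hkl, hg]
      rw [← hdilate (oddVec g)]
      congr 1
      ext i
      fin_cases i
      · exact hn _ _ rfl
      · exact hn _ _ rfl
      · exact hn _ _ rfl
      · exact congrArg g rfl
      · exact congrArg g rfl
      · exact congrArg g rfl
    have hpow (k : ℕ) (g : ZMod 13 → ℂ) (hg : g.Odd) :
        Q (oddVec (dilate (2 ^ k) g)) = Q (oddVec g) := by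
      induction k with
      | zero => congr 2; ext t; simp [dilate]
      | succ k ih =>
        rw [← ih, ← htwo (dilate (2 ^ k) g) (odd_dilate hg _)]
        congr 2
        ext t
        rw [dilate, dilate, dilate, pow_succ, mul_assoc]
    have hgen : ∀ u : ZMod 13, u ≠ 0 → ∃ k ∈ Finset.range 12, u = 2 ^ k := by decide
    intro u hu g hg
    obtain ⟨k, -, rfl⟩ := hgen u hu
    exact hpow k g hg

theorem isBorelInvariant_wInf : IsBorelInvariant 2 (wInf ∘ oddVec) :=
  isBorelInvariant_of_generators
    (fun c v => by simp only [wInf, AA0, Pi.smul_apply, smul_eq_mul]; ring)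
    (fun y hy v => by rw [wInf, (AA_diagAct hy v).1, wInf])
    (fun v => by simp only [wInf, AA0, Matrix.cons_val]; ring)

theorem isBorelInvariant_dInf : IsBorelInvariant 3 (dInf ∘ oddVec) :=
  isBorelInvariant_of_generators
    (fun c v => by simp only [dInf, GG0, DD0, DDinf, Pi.smul_apply, smul_eq_mul]; ring)
    (fun y hy v => by rw [dInf, (GG_diagAct hy v).1, dInf])
    (fun v => by simp only [dInf, GG0, DD0, DDinf, Matrix.cons_val]; ring)

theorem orbitSum_comp_oddVec {m : ℕ} {Q : (Fin 6 → ℂ) → ℂ} {R : ℕ → (Fin 6 → ℂ) → ℂ}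
    (h₀ : ∀ v, Q (fourierAct v) = 13 ^ m * R 0 v)
    (h : ∀ ν v, R ν v = R 0 (diagAct (ζ ^ ν) v)) (N : ℕ) {g : ZMod 13 → ℂ} (hg : g.Odd) :
    orbitSum m (Q ∘ oddVec) N g
      = 13 ^ (m * N) * (∑ ν ∈ Finset.range 13, R ν (oddVec g) ^ N + Q (oddVec g) ^ N) := by
  have hν (n : ℕ) : Q (oddVec (dft13 (twist n g))) = 13 ^ m * R n (oddVec g) := by
    rw [oddVec_dft (odd_twist hg _), h₀, h n, oddVec_twist, chi_natCast]
  simp only [orbitSum, sum_zmod_thirteen, Function.comp_apply, hν, mul_pow, ← Finset.mul_sum,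
    ← pow_mul]
  ring

/-! ### Theta functions of order thirteen as a vector-valued function on `ZMod 13` -/

def thetaTerm (z : ℂ) (m : ℤ) : ℂ := (-1) ^ m * exp (Real.pi * I * z * (2 * m + 13) ^ 2 / 52)

/-- The theta function attached to a residue class modulo `13`. -/
def thetaFun (z : ℂ) (t : ZMod 13) : ℂ := ∑' n : ℤ, thetaTerm z (13 * n + (t.val : ℤ))

theorem neg_one_zpow_eq_exp (m : ℤ) : (-1 : ℂ) ^ m = exp (Real.pi * I * m) := by
  rw [← exp_pi_mul_I, ← exp_int_mul, mul_comm]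

theorem chi_intCast (m : ℤ) : chi (m : ZMod 13) = exp (2 * Real.pi * I * m / 13) :=
  (ZMod.stdAddChar_coe (N := 13) m).trans (by norm_num)

theorem exp_two_pi_int (n : ℤ) : exp (2 * Real.pi * I * n) = 1 := by
  rw [mul_comm]
  exact exp_int_mul_two_pi_mul_I n

theorem exp_eq_exp_of_int {x y : ℂ} (n : ℤ) (h : x = y + 2 * Real.pi * I * n) :
    exp x = exp y := by
  rw [h, exp_add, exp_two_pi_int, mul_one]

theorem thetaTerm_eq (z : ℂ) (m : ℤ) :
    thetaTerm z m
      = exp (13 * Real.pi * I * z / 4) * jacobiTheta₂_term m (1 / 2 + z / 2) (z / 13) := by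
  rw [thetaTerm, jacobiTheta₂_term, neg_one_zpow_eq_exp, ← exp_add, ← exp_add]
  congr 1
  ring

theorem summable_thetaTerm {z : ℂ} (hz : 0 < z.im) : Summable (thetaTerm z) := by
  rw [funext (thetaTerm_eq z)]
  refine Summable.mul_left _ ((summable_jacobiTheta₂_term_iff _ _).mpr ?_)
  rw [show z / 13 = z / (13 : ℝ) by norm_num, div_ofReal_im]
  positivity

theorem thetaFun_intCast (z : ℂ) (m : ℤ) :
    thetaFun z (m : ZMod 13) = ∑' n : ℤ, thetaTerm z (13 * n + m) := by
  rw [thetaFun, ZMod.val_intCast, ← (Equiv.addRight (m / 13)).tsum_eq]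
  refine tsum_congr fun n => ?_
  rw [Equiv.coe_addRight]
  congr 1
  have := Int.emod_add_mul_ediv m 13
  push_cast
  linarith

theorem exists_intCast (t : ZMod 13) : ∃ m : ℤ, (m : ZMod 13) = t := ZMod.intCast_surjective t

theorem odd_thetaFun (z : ℂ) : (thetaFun z).Odd := fun t => by
  obtain ⟨m, rfl⟩ := exists_intCast t
  rw [← Int.cast_neg, thetaFun_intCast, thetaFun_intCast, ← tsum_neg,
    ← (Equiv.subLeft (-1 : ℤ)).tsum_eq]
  refine tsum_congr fun n => ?_
  rw [Equiv.subLeft_apply, thetaTerm, thetaTerm, ← neg_mul,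
    show (-1 : ℂ) ^ (13 * (-1 - n) + -m) = -(-1) ^ (13 * n + m) by
      rw [show 13 * (-1 - n) + -m = -(13 * n + m) - 13 by ring, zpow_sub₀ (by norm_num), zpow_neg,
        ← inv_zpow]
      norm_num [zpow_ofNat, div_neg]]
  congr 2
  push_cast
  ring

theorem thetaFun_eq_jacobiTheta₂ (z : ℂ) (m : ℤ) :
    thetaFun z (m : ZMod 13)
      = (-1) ^ m * exp (Real.pi * I * z * (2 * m + 13) ^ 2 / 52)
        * jacobiTheta₂ (1 / 2 + (2 * m + 13) * z / 2) (13 * z) := by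
  rw [thetaFun_intCast, jacobiTheta₂, ← tsum_mul_left]
  refine tsum_congr fun n => ?_
  rw [thetaTerm, jacobiTheta₂_term, neg_one_zpow_eq_exp, neg_one_zpow_eq_exp, ← exp_add,
    ← exp_add, ← exp_add]
  refine exp_eq_exp_of_int (6 * n) ?_
  push_cast
  ring

theorem exists_equiv_zmod_prod_int :
    ∃ e : ZMod 13 × ℤ ≃ ℤ, ∀ s n, e (s, n) = 13 * n + (s.val : ℤ) :=
  ⟨((Int.divModEquiv 13).trans (Equiv.prodComm _ _)).symm, fun s n => by
    change n * ((13 : ℕ) : ℤ) + (s.val : ℤ) = _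
    ring⟩

theorem dft_thetaFun {z : ℂ} (hz : 0 < z.im) (t : ZMod 13) :
    dft13 (thetaFun z) t = ∑' m : ℤ, chi (m * t) * thetaTerm z m := by
  have hs : Summable fun m : ℤ => chi (m * t) * thetaTerm z m :=
    .of_norm (by simpa [chi] using (summable_thetaTerm hz).norm)
  obtain ⟨e, he⟩ := exists_equiv_zmod_prod_int
  have hs' : Summable fun p => chi (e p * t) * thetaTerm z (e p) := e.summable_iff.mpr hs
  rw [← e.tsum_eq, hs'.tsum_prod, tsum_fintype, dft13]
  refine Finset.sum_congr rfl fun s _ => ?_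
  rw [thetaFun, ← tsum_mul_left]
  refine tsum_congr fun n => ?_
  have hc : ((13 * n + (s.val : ℤ) : ℤ) : ZMod 13) = s := by
    push_cast
    rw [ZMod.natCast_zmod_val, show (13 : ZMod 13) = 0 from rfl, zero_mul, zero_add]
  rw [he, hc]

theorem dft_thetaFun_eq_jacobiTheta₂ {z : ℂ} (hz : 0 < z.im) (t : ℤ) :
    dft13 (thetaFun z) (t : ZMod 13)
      = -exp (-(14 * Real.pi * I * t / 13) + Real.pi * I * z / 52)
        * jacobiTheta₂ (1 / 2 + t / 13 - z / 26) (z / 13) := by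
  rw [dft_thetaFun hz, ← (Equiv.subRight (7 : ℤ)).tsum_eq, jacobiTheta₂, ← tsum_mul_left]
  refine tsum_congr fun n => ?_
  rw [Equiv.subRight_apply, ← Int.cast_mul, chi_intCast, thetaTerm, jacobiTheta₂_term,
    neg_one_zpow_eq_exp, ← exp_add, ← exp_add, neg_mul, ← exp_add, ← exp_add_pi_mul_I]
  refine exp_eq_exp_of_int (-4) ?_
  push_cast
  ring

theorem thetaFun_neg_inv {z : ℂ} (hz : 0 < z.im) :
    thetaFun (-1 / z) = (I / (13 * I / z) ^ (1 / 2 : ℂ)) • dft13 (thetaFun z) := by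
  have hz0 : z ≠ 0 := by rintro rfl; simp at hz
  ext t
  obtain ⟨m, rfl⟩ := exists_intCast t
  rw [Pi.smul_apply, dft_thetaFun_eq_jacobiTheta₂ hz, thetaFun_eq_jacobiTheta₂,
    jacobiTheta₂_functional_equation, smul_eq_mul]
  rw [show (1 / 2 + (2 * m + 13) * (-1 / z) / 2) / (13 * (-1 / z)) = 1 / 2 + m / 13 - z / 26 by
      field_simp; ring,
    show -1 / (13 * (-1 / z)) = z / 13 by field_simp,
    show -I * (13 * (-1 / z)) = 13 * I / z by ring]
  have h : (-1) ^ m * exp (Real.pi * I * (-1 / z) * (2 * m + 13) ^ 2 / 52)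
      * exp (-Real.pi * I * (1 / 2 + (2 * m + 13) * (-1 / z) / 2) ^ 2 / (13 * (-1 / z)))
      = I * -exp (-(14 * Real.pi * I * m / 13) + Real.pi * I * z / 52) := by
    have hI (x : ℂ) : I * -exp x = exp (x + Real.pi * I + Real.pi / 2 * I) := by
      rw [exp_add, exp_pi_div_two_mul_I, exp_add_pi_mul_I, mul_comm]
    rw [hI, neg_one_zpow_eq_exp, ← exp_add, ← exp_add]
    refine exp_eq_exp_of_int (m - 1) ?_
    push_cast
    field_simp
    ring
  linear_combination (jacobiTheta₂ (1 / 2 + m / 13 - z / 26) (z / 13)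
    / (13 * I / z) ^ (1 / 2 : ℂ)) * h

theorem thetaFun_add_one (z : ℂ) :
    thetaFun (z + 1) = exp (13 * Real.pi * I / 4) • twist 1 (thetaFun z) := by
  ext t
  obtain ⟨m, rfl⟩ := exists_intCast t
  rw [Pi.smul_apply, twist, thetaFun_intCast, thetaFun_intCast, smul_eq_mul, ← tsum_mul_left,
    ← tsum_mul_left]
  refine tsum_congr fun n => ?_
  rw [show (7 * 1 * (m : ZMod 13) ^ 2) = ((7 * (13 * n + m) ^ 2 : ℤ) : ZMod 13) by
    push_cast
    rw [show (13 : ZMod 13) = 0 from rfl]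
    ring, chi_intCast, thetaTerm, thetaTerm, neg_one_zpow_eq_exp, ← exp_add, ← exp_add, ← exp_add,
    ← exp_add]
  obtain ⟨k, hk⟩ : (2 : ℤ) ∣ (13 * n + m) * (13 * n + m - 1) := by
    simpa using (Int.even_mul_pred_self (13 * n + m)).two_dvd
  have hk' : (13 * n + m : ℂ) * (13 * n + m - 1) = 2 * k := by exact_mod_cast hk
  refine exp_eq_exp_of_int (-k) ?_
  push_cast
  linear_combination (-(Real.pi * I)) * hk'

theorem thetaFun_eq_th13 (z : ℂ) (m : ℤ) {l : ℤ} {c : ℚ} (hl : l = 2 * m + 13)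
    (hc : c = l ^ 2 / 104) : thetaFun z (m : ZMod 13) = (-1) ^ m * th13 c l z := by
  subst hl hc
  rw [thetaFun_intCast, th13, ← tsum_mul_left, ← tsum_mul_left]
  refine tsum_congr fun n => ?_
  rw [thetaTerm, neg_one_zpow_eq_exp, neg_one_zpow_eq_exp, neg_one_zpow_eq_exp, ← exp_add,
    ← exp_add, ← exp_add, ← exp_add]
  refine exp_eq_exp_of_int (6 * n) ?_
  push_cast
  ring

theorem oddVec_thetaFun (z : ℂ) : oddVec (thetaFun z) = AV z := by
  have h₁ : thetaFun z 1 = -thetaFun z ((-1 : ℤ) : ZMod 13) := odd_thetaFun z (-1)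
  have h₃ : thetaFun z 3 = -thetaFun z ((-3 : ℤ) : ZMod 13) := odd_thetaFun z (-3)
  rw [thetaFun_eq_th13 z (-1) (l := 11) (c := 121 / 104) (by norm_num) (by norm_num)] at h₁
  rw [thetaFun_eq_th13 z (-3) (l := 7) (c := 49 / 104) (by norm_num) (by norm_num)] at h₃
  have h₉ := thetaFun_eq_th13 z (-4) (l := 5) (c := 25 / 104) (by norm_num) (by norm_num)
  have h₈ := thetaFun_eq_th13 z (-5) (l := 3) (c := 9 / 104) (by norm_num) (by norm_num)
  have h₁₁ := thetaFun_eq_th13 z (-2) (l := 9) (c := 81 / 104) (by norm_num) (by norm_num)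
  have h₇ := thetaFun_eq_th13 z (-6) (l := 1) (c := 1 / 104) (by norm_num) (by norm_num)
  rw [show ((-4 : ℤ) : ZMod 13) = 9 from rfl] at h₉
  rw [show ((-5 : ℤ) : ZMod 13) = 8 from rfl] at h₈
  rw [show ((-2 : ℤ) : ZMod 13) = 11 from rfl] at h₁₁
  rw [show ((-6 : ℤ) : ZMod 13) = 7 from rfl] at h₇
  ext i
  rw [oddVec, AV, ta, h₁, h₃, h₉, h₈, h₁₁, h₇]
  fin_cases i <;> norm_num [zpow_neg, zpow_ofNat]

/-! ### Forms of level one -/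

theorem etaF_eq_eta (z : ℂ) : etaF z = ModularForm.eta z := by
  simp [etaF, ModularForm.eta, ModularForm.eta_q_eq_pow, Function.Periodic.qParam]

theorem Eis_eq_E {k : ℕ} (hk : 3 ≤ k) (z : UpperHalfPlane) : Eis k z = ModularForm.E hk z := by
  change _ = (1 / 2 : ℂ) * ∑' x : EisensteinSeries.gammaSet 1 1 0, _
  rw [Eis]
  congr 1
  let e : {p : ℤ × ℤ // Int.gcd p.1 p.2 = 1} ≃ EisensteinSeries.gammaSet 1 1 0 :=
    (finTwoArrowEquiv ℤ).symm.subtypeEquiv fun p => by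
      rw [EisensteinSeries.gammaSet_one_mem_iff]
      rfl
  rw [← e.tsum_eq]
  refine tsum_congr fun p => ?_
  simp [e, EisensteinSeries.eisSummand, one_div]

open UpperHalfPlane ModularForm EisensteinSeries SlashInvariantForm Filter Topology MatrixGroups in
/-- The spaces of level one forms of small even weight are spanned by the Eisenstein series. -/
theorem eq_Eis_of_tendsto {k : ℕ} (hk : 3 ≤ k) (hk₂ : Even k) (hk₁₂ : k < 12) {f : ℂ → ℂ}
    (hf : ∀ z : ℂ, 0 < z.im → DifferentiableAt ℂ f z)
    (hT : ∀ z : ℂ, 0 < z.im → f (z + 1) = f z)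
    (hS : ∀ z : ℂ, 0 < z.im → f (-1 / z) = z ^ k * f z)
    (hlim : Tendsto (fun z : ℍ => f z) atImInfty (𝓝 1)) {z : ℂ} (hz : 0 < z.im) :
    f z = Eis k z := by
  have hT' : (fun z : ℍ => f z) ∣[(k : ℤ)] ModularGroup.T = fun z : ℍ => f z := by
    ext τ
    have hd : denom ModularGroup.T τ = 1 := by
      rw [ModularGroup.denom_apply, ModularGroup.coe_T]
      simp
    rw [SL_slash_apply, modular_T_smul, hd, one_zpow, mul_one, coe_vadd, add_comm, ofReal_one]
    exact hT τ τ.2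
  have hS' : (fun z : ℍ => f z) ∣[(k : ℤ)] ModularGroup.S = fun z : ℍ => f z := by
    ext τ
    have h := hS τ τ.2
    rw [neg_div, one_div] at h
    rw [SL_slash_apply, modular_S_smul, ModularGroup.denom_S, UpperHalfPlane.coe_mk, inv_neg, h,
      zpow_neg, zpow_natCast, mul_comm, inv_mul_cancel_left₀ (pow_ne_zero _ τ.ne_zero)]
  let F : ModularForm 𝒮ℒ k :=
    { toFun := fun z : ℍ => f z
      slash_action_eq' := by
        rintro _ ⟨A, rfl⟩
        exact slash_action_generators_SL2Z hS' hT' A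
      holo' := by
        rw [UpperHalfPlane.mdifferentiable_iff]
        refine .congr (fun z hz ↦ (hf z hz).differentiableWithinAt) fun z hz ↦ ?_
        simp [ofComplex_apply_of_im_pos hz]
      bdd_at_cusps' := fun hc => by
        rw [Subgroup.IsArithmetic.isCusp_iff_isCusp_SL2Z] at hc
        rw [OnePoint.isBoundedAt_iff_forall_SL2Z hc]
        intro γ _
        rw [slash_action_generators_SL2Z hS' hT']
        exact hlim.isBigO_one ℝ }
  have hrank : Module.rank ℂ (ModularForm 𝒮ℒ k) = 1 := by
    rw [rank_eq_one_add_rank_cuspForm hk hk₂,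
      CuspForm.rank_eq_zero_of_weight_lt_twelve (by exact_mod_cast hk₁₂), add_zero]
  obtain ⟨c, hc⟩ := (finrank_eq_one_iff_of_nonzero' (E hk) (E_ne_zero hk hk₂)).mp
    (Module.rank_eq_one_iff_finrank_eq_one.mp hrank) F
  have hF : (qExpansion 1 F).coeff 0 = 1 := by
    rw [qExpansion_coeff_zero one_pos
      (ModularFormClass.analyticAt_cuspFunction_zero F one_pos one_mem_strictPeriods_SL)
      (SlashInvariantFormClass.periodic_comp_ofComplex F one_mem_strictPeriods_SL)]
    exact hlim.limUnder_eq
  have hc₁ : c = 1 := by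
    rw [← hF, ← hc]
    have := ModularForm.qExpansion_smul one_pos one_mem_strictPeriods_SL c (E hk)
    change _ = (qExpansion 1 (c • (E hk : ℍ → ℂ))).coeff 0
    rw [this, PowerSeries.coeff_smul, E_qExpansion_coeff_zero hk hk₂, smul_eq_mul, mul_one]
  have h := congrArg (fun G : ModularForm 𝒮ℒ k => G ⟨z, hz⟩) hc
  rw [hc₁, one_smul] at h
  exact h.symm.trans (Eis_eq_E hk ⟨z, hz⟩).symm

/-! ### Transformation of the power sums of theta constants -/

theorem eta_neg_inv_pow_six {z : ℂ} (hz : 0 < z.im) :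
    etaF (-1 / z) ^ 6 = I * z ^ 3 * etaF z ^ 6 := by
  have hz₀ : z ≠ 0 := by rintro rfl; simp at hz
  have h : ModularForm.eta (-1 / z) = (sqrt I)⁻¹ * (sqrt z * ModularForm.eta z) :=
    ModularForm.eta_comp_eq_csqrt_I_inv hz
  have hsq (w : ℂ) : sqrt w ^ 2 = w := by
    rw [sqrt, ← cpow_nat_mul]
    norm_num
  rw [etaF_eq_eta, etaF_eq_eta, h, mul_pow, mul_pow, inv_pow, show 6 = 2 * 3 from rfl,
    pow_mul (sqrt I), pow_mul (sqrt z), hsq, hsq, I_pow_three, inv_neg, inv_I, neg_neg, mul_assoc]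

theorem eta_add_one_pow_six (z : ℂ) : etaF (z + 1) ^ 6 = I * etaF z ^ 6 := by
  have h : exp (2 * Real.pi * I * (z + 1)) = exp (2 * Real.pi * I * z) := by
    rw [mul_add, mul_one, exp_add, exp_two_pi_mul_I, mul_one]
  have h' : exp (2 * Real.pi * I * (z + 1) / 24) ^ 6 = I * exp (2 * Real.pi * I * z / 24) ^ 6 := by
    rw [← exp_nat_mul, ← exp_nat_mul, ← congrArg (· * _) exp_pi_div_two_mul_I, ← exp_add]
    congr 1
    push_cast
    ring
  rw [etaF, etaF, h, mul_pow, h', mul_pow, mul_assoc]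

namespace IsBorelInvariant

variable {m : ℕ} {Q : (ZMod 13 → ℂ) → ℂ}

theorem orbitSum_thetaFun_neg_inv (hQ : IsBorelInvariant m Q) (N : ℕ) {z : ℂ} (hz : 0 < z.im) :
    orbitSum m Q N (thetaFun (-1 / z)) = (I * z) ^ (m * N) * orbitSum m Q N (thetaFun z) := by
  have hz₀ : z ≠ 0 := by rintro rfl; simp at hz
  have hκ : (I / (13 * I / z) ^ (1 / 2 : ℂ)) ^ 2 * 13 = I * z := by
    rw [div_pow, ← cpow_nat_mul]
    norm_num
    field_simp
    simp
  rw [thetaFun_neg_inv hz, hQ.orbitSum_smul, hQ.orbitSum_dft N (odd_thetaFun z), mul_assoc 2,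
    pow_mul _ 2, ← mul_assoc, ← mul_pow, hκ]

theorem orbitSum_thetaFun_add_one (hQ : IsBorelInvariant m Q) (N : ℕ) (z : ℂ) :
    orbitSum m Q N (thetaFun (z + 1)) = I ^ (m * N) * orbitSum m Q N (thetaFun z) := by
  have h : exp (13 * Real.pi * I / 4) ^ 2 = I := by
    rw [← exp_nat_mul]
    refine (exp_eq_exp_of_int 3 ?_).trans exp_pi_div_two_mul_I
    push_cast
    ring
  rw [thetaFun_add_one, hQ.orbitSum_smul, hQ.orbitSum_twist N 1 (odd_thetaFun z), mul_assoc 2,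
    pow_mul _ 2, h]

end IsBorelInvariant

theorem differentiableAt_thetaFun (t : ZMod 13) {z : ℂ} (hz : 0 < z.im) :
    DifferentiableAt ℂ (fun z => thetaFun z t) z := by
  obtain ⟨m, rfl⟩ := exists_intCast t
  rw [funext fun z => thetaFun_eq_jacobiTheta₂ z m]
  have h : DifferentiableAt ℂ
      (fun z : ℂ => jacobiTheta₂ (1 / 2 + (2 * m + 13) * z / 2) (13 * z)) z := by
    have h₁ := (hasFDerivAt_jacobiTheta₂ (1 / 2 + (2 * m + 13) * z / 2)
      (τ := 13 * z) (by simpa using hz)).differentiableAt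
    exact h₁.comp (f := fun z : ℂ => (1 / 2 + (2 * m + 13) * z / 2, 13 * z)) z (by fun_prop)
  exact DifferentiableAt.mul (by fun_prop) h

theorem differentiableAt_AV {z : ℂ} (hz : 0 < z.im) : DifferentiableAt ℂ AV z := by
  rw [← funext oddVec_thetaFun, differentiableAt_pi]
  intro i
  fin_cases i <;> exact differentiableAt_thetaFun _ hz

/-! ### Truncated power series with integer coefficients -/

/-- The polynomial with the given list of coefficients, lowest degree first. -/
def coeffSum : List ℤ → ℂ → ℂ
  | [], _ => 0
  | a :: l, u => a + u * coeffSum l u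

/-- Coefficientwise sum. -/
def coeffAdd : List ℤ → List ℤ → List ℤ
  | [], l => l
  | a :: k, [] => a :: k
  | a :: k, b :: l => (a + b) :: coeffAdd k l

/-- Product of coefficient lists. -/
def coeffMul : List ℤ → List ℤ → List ℤ
  | [], _ => []
  | a :: k, l => coeffAdd (l.map (a * ·)) (0 :: coeffMul k l)

/-- Powers of a coefficient list, truncated to fifteen coefficients. -/
def coeffPow (l : List ℤ) : ℕ → List ℤ
  | 0 => [1]
  | n + 1 => (coeffMul (coeffPow l n) (l.take 15)).take 15

theorem coeffSum_add (k l : List ℤ) (u : ℂ) :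
    coeffSum (coeffAdd k l) u = coeffSum k u + coeffSum l u := by
  fun_induction coeffAdd k l with
  | case1 => simp [coeffSum]
  | case2 => simp [coeffSum]
  | case3 a k b l ih =>
    simp only [coeffSum, ih, Int.cast_add]
    ring

theorem coeffSum_map_mul (a : ℤ) (l : List ℤ) (u : ℂ) :
    coeffSum (l.map (a * ·)) u = a * coeffSum l u := by
  induction l with
  | nil => simp [coeffSum]
  | cons b l ih =>
    simp only [List.map_cons, coeffSum, ih, Int.cast_mul]
    ring

theorem coeffSum_mul (k l : List ℤ) (u : ℂ) :
    coeffSum (coeffMul k l) u = coeffSum k u * coeffSum l u := by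
  induction k with
  | nil => simp [coeffMul, coeffSum]
  | cons a k ih =>
    simp only [coeffMul, coeffSum_add, coeffSum_map_mul, coeffSum, ih, Int.cast_zero]
    ring

theorem coeffSum_take_add_drop (l : List ℤ) (n : ℕ) (u : ℂ) :
    coeffSum l u = coeffSum (l.take n) u + u ^ n * coeffSum (l.drop n) u := by
  induction n generalizing l with
  | zero => simp [coeffSum]
  | succ n ih =>
    cases l with
    | nil => simp [coeffSum]
    | cons a l =>
      simp only [List.take_succ_cons, List.drop_succ_cons, coeffSum]
      rw [ih l]
      ring

theorem continuous_coeffSum (l : List ℤ) : Continuous (coeffSum l) := by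
  induction l with
  | nil => exact continuous_const
  | cons a l ih => exact continuous_const.add (continuous_id.mul ih)

theorem coeffSum_eq_sum {l : List ℤ} {n : ℕ} (hl : l.length ≤ n) (u : ℂ) :
    coeffSum l u = ∑ j ∈ Finset.range n, (l.getD j 0 : ℂ) * u ^ j := by
  induction l generalizing n with
  | nil => simp [coeffSum]
  | cons a l ih =>
    obtain ⟨n, rfl⟩ : ∃ k, n = k + 1 := ⟨n - 1, by simp at hl; omega⟩
    rw [Finset.sum_range_succ', coeffSum, ih (by simpa using hl), Finset.mul_sum, add_comm]
    simp only [List.getD_cons_succ, List.getD_cons_zero, pow_zero, mul_one]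
    congr 1
    exact Finset.sum_congr rfl fun j _ => by ring

/-- `f` agrees with the polynomial with coefficients `l` up to order `u ^ 15`. -/
def HasJet (f : ℂ → ℂ) (l : List ℤ) : Prop :=
  ∃ W : ℂ → ℂ, Continuous W ∧ ∀ u, f u = coeffSum l u + u ^ 15 * W u

theorem hasJet_coeffSum (l : List ℤ) : HasJet (coeffSum l) (l.take 15) :=
  ⟨coeffSum (l.drop 15), continuous_coeffSum _, coeffSum_take_add_drop l 15⟩

theorem HasJet.mul {f g : ℂ → ℂ} {k l : List ℤ} (hf : HasJet f k) (hg : HasJet g l) :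
    HasJet (fun u => f u * g u) ((coeffMul k l).take 15) := by
  obtain ⟨V, hV, hfV⟩ := hf
  obtain ⟨W, hW, hgW⟩ := hg
  have hk := continuous_coeffSum k
  have hl := continuous_coeffSum l
  have hd := continuous_coeffSum ((coeffMul k l).drop 15)
  refine ⟨fun u => coeffSum ((coeffMul k l).drop 15) u + coeffSum k u * W u + V u * coeffSum l u
    + u ^ 15 * (V u * W u), by fun_prop, fun u => ?_⟩
  have := coeffSum_take_add_drop (coeffMul k l) 15 u
  rw [coeffSum_mul] at this
  simp only [hfV, hgW]
  linear_combination this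

theorem hasJet_coeffSum_pow (l : List ℤ) (n : ℕ) :
    HasJet (fun u => coeffSum l u ^ n) (coeffPow l n) := by
  induction n with
  | zero => exact ⟨0, continuous_const, fun u => by simp [coeffPow, coeffSum]⟩
  | succ n ih =>
    simp only [pow_succ]
    exact ih.mul (hasJet_coeffSum l)

theorem sum_zeta_pow_mul (k : ℕ) :
    ∑ ν ∈ Finset.range 13, (ζ ^ ν) ^ k = if 13 ∣ k then 13 else 0 := by
  have h := sum_chi_mul (k : ZMod 13)
  rw [sum_zmod_thirteen] at h
  simp only [ZMod.natCast_eq_zero_iff] at h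
  rw [← h]
  refine Finset.sum_congr rfl fun ν _ => ?_
  rw [← pow_mul, ← chi_natCast, Nat.cast_mul]

/-- Averaging a jet over rotations by thirteenth roots of unity isolates one coefficient. -/
theorem HasJet.sum_rotate {f : ℂ → ℂ} {l : List ℤ} (hf : HasJet f l) (hl : l.length ≤ 15)
    {a d : ℕ} (hd : d < 15) (had : 13 ∣ a + d)
    (h : ∀ j < 15, 13 ∣ a + j → j ≠ d → l.getD j 0 = 0) :
    ∃ W : ℂ → ℂ, Continuous W ∧ ∀ u,
      ∑ ν ∈ Finset.range 13, (ζ ^ ν) ^ a * f (ζ ^ ν * u) =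
        13 * (l.getD d 0 : ℂ) * u ^ d + u ^ 15 * W u := by
  obtain ⟨V, hV, hfV⟩ := hf
  refine ⟨fun u => ∑ ν ∈ Finset.range 13, (ζ ^ ν) ^ (a + 15) * V (ζ ^ ν * u), by fun_prop,
    fun u => ?_⟩
  have hmain : ∑ ν ∈ Finset.range 13, (ζ ^ ν) ^ a * coeffSum l (ζ ^ ν * u) =
      13 * (l.getD d 0 : ℂ) * u ^ d := by
    simp only [coeffSum_eq_sum hl, Finset.mul_sum]
    rw [Finset.sum_comm]
    have (j : ℕ) : ∑ ν ∈ Finset.range 13, (ζ ^ ν) ^ a * ((l.getD j 0 : ℂ) * (ζ ^ ν * u) ^ j) =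
        (if 13 ∣ a + j then 13 else 0) * ((l.getD j 0 : ℂ) * u ^ j) := by
      rw [← sum_zeta_pow_mul, Finset.sum_mul]
      exact Finset.sum_congr rfl fun ν _ => by ring
    simp only [this]
    rw [Finset.sum_eq_single_of_mem d (Finset.mem_range.2 hd), if_pos had, mul_assoc]
    intro j hj hjd
    split_ifs with hdvd
    · rw [h j (Finset.mem_range.1 hj) hdvd hjd]
      simp
    · simp
  rw [← hmain, Finset.mul_sum, ← Finset.sum_add_distrib]
  refine Finset.sum_congr rfl fun ν _ => ?_
  rw [hfV]
  ring

/-- The leading terms of the theta constants at the cusp, in terms of `u = exp (2πiz/13)`. -/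
def thetaLead (u : ℂ) : Fin 6 → ℂ := ![u ^ 15, u ^ 6, u ^ 3, -u, u ^ 10, 1]

theorem diagAct_thetaLead {y : ℂ} (hy : y ^ 13 = 1) (u : ℂ) :
    diagAct y (thetaLead u) = y ^ 5 • thetaLead (y * u) := by
  ext i
  fin_cases i <;> simp only [diagAct, thetaLead, Pi.smul_apply, smul_eq_mul, mul_pow] <;>
    simp <;> ring_nf <;> simp only [pow_reduce_thirteen hy, Nat.reduceLeDiff, Nat.reduceSub]

theorem wF_smul (ν : ℕ) (c : ℂ) (v : Fin 6 → ℂ) : wF ν (c • v) = c ^ 4 * wF ν v := by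
  simp only [wF, AA0, AA1, AA2, AA3, AA4, AA5, AA6, Pi.smul_apply, smul_eq_mul]
  ring

theorem wInf_smul (c : ℂ) (v : Fin 6 → ℂ) : wInf (c • v) = c ^ 4 * wInf v := by
  simp only [wInf, AA0, Pi.smul_apply, smul_eq_mul]
  ring

theorem DD_smul (c : ℂ) (v : Fin 6 → ℂ) :
    DD0 (c • v) = c ^ 3 * DD0 v ∧ DD1 (c • v) = c ^ 3 * DD1 v ∧ DD2 (c • v) = c ^ 3 * DD2 v ∧
    DD3 (c • v) = c ^ 3 * DD3 v ∧ DD4 (c • v) = c ^ 3 * DD4 v ∧ DD5 (c • v) = c ^ 3 * DD5 v ∧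
    DD6 (c • v) = c ^ 3 * DD6 v ∧ DD7 (c • v) = c ^ 3 * DD7 v ∧ DD8 (c • v) = c ^ 3 * DD8 v ∧
    DD9 (c • v) = c ^ 3 * DD9 v ∧ DD10 (c • v) = c ^ 3 * DD10 v ∧
    DD11 (c • v) = c ^ 3 * DD11 v ∧ DD12 (c • v) = c ^ 3 * DD12 v ∧
    DDinf (c • v) = c ^ 3 * DDinf v := by
  refine ⟨?_, ?_, ?_, ?_, ?_, ?_, ?_, ?_, ?_, ?_, ?_, ?_, ?_, ?_⟩ <;>
  · simp only [DD0, DD1, DD2, DD3, DD4, DD5, DD6, DD7, DD8, DD9, DD10, DD11, DD12, DDinf,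
      Pi.smul_apply, smul_eq_mul]
    ring

theorem dInf_smul (c : ℂ) (v : Fin 6 → ℂ) : dInf (c • v) = c ^ 6 * dInf v := by
  simp only [dInf, GG0, DD_smul]
  ring

theorem dF_smul (ν : ℕ) (c : ℂ) (v : Fin 6 → ℂ) : dF ν (c • v) = c ^ 6 * dF ν v := by
  obtain ⟨h0, h1, h2, h3, h4, h5, h6, h7, h8, h9, h10, h11, h12, hinf⟩ := DD_smul c v
  simp only [dF, GG0, GG1, GG2, GG3, GG4, GG5, GG6, GG7, GG8, GG9, GG10, GG11, GG12, h0, h1, h2,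
    h3, h4, h5, h6, h7, h8, h9, h10, h11, h12, hinf]
  ring

theorem wF_thetaLead (ν : ℕ) (u : ℂ) :
    wF ν (thetaLead u) = (ζ ^ ν) ^ 20 * wF 0 (thetaLead (ζ ^ ν * u)) := by
  rw [wF_eq_wF_zero, diagAct_thetaLead (zeta_pow_pow ν), wF_smul, ← pow_mul]

theorem dF_thetaLead (ν : ℕ) (u : ℂ) :
    dF ν (thetaLead u) = (ζ ^ ν) ^ 30 * dF 0 (thetaLead (ζ ^ ν * u)) := by
  rw [dF_eq_dF_zero, diagAct_thetaLead (zeta_pow_pow ν), dF_smul, ← pow_mul]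

/-- The coefficients of a square root of `wF 0 (thetaLead u)`. -/
def wCoeffs : List ℤ :=
  [-1, 0, -1, 1, 2, 0, -1, 2, 0, 0, 0, 0, 1, -2, 0, -2, 0, 0, 0, 0, -1, 0, 0, 0, 0, -2, 0, 0, 0,
    0, 1]

/-- The coefficients of `dF 0 (thetaLead u)`. -/
def dCoeffs : List ℤ :=
  [-1, 2, 2, -2, -8, 6, 1, -8, 17, 0, 13, -22, -21, 4, -4, 32, -10, -14, 8, 34, 2, 12, -13, -42,
    -20, -14, -8, -2, 36, 36, 18, 8, 43, -72, -33, 0, 38, 30, -58, 0, -32, 0, 40, 10, 1, -18,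
    -22, 22, -13, -26, 58, 8, -45, 62, -4, -38, 14, 12, 20, 6, -24, 0, -29, -2, 22, -6, 8, -12,
    -2, -6, 1, 12, 2, -10, 0, -2, -10, 0, 4, 0, 0, -2, 0, 0, 0, 2, 0, 0, 0, 0, -1]

theorem wF_zero_thetaLead (u : ℂ) : wF 0 (thetaLead u) = coeffSum wCoeffs u ^ 2 := by
  simp only [wF, AA0, AA1, AA2, AA3, AA4, AA5, AA6, thetaLead, Matrix.cons_val, mul_zero, pow_zero,
    coeffSum, wCoeffs]
  push_cast
  ring

theorem dF_zero_thetaLead (u : ℂ) : dF 0 (thetaLead u) = coeffSum dCoeffs u := by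
  simp only [dF, GG0, GG1, GG2, GG3, GG4, GG5, GG6, GG7, GG8, GG9, GG10, GG11, GG12, DD0, DD1, DD2,
    DD3, DD4, DD5, DD6, DD7, DD8, DD9, DD10, DD11, DD12, DDinf, thetaLead, Matrix.cons_val,
    mul_zero, pow_zero, coeffSum, dCoeffs]
  push_cast
  ring

theorem sum_wF_pow_thetaLead (N : ℕ) {d : ℕ} (hd : d < 15) (had : 13 ∣ 20 * N + d)
    (hlen : (coeffPow wCoeffs (2 * N)).length ≤ 15)
    (h : ∀ j < 15, 13 ∣ 20 * N + j → j ≠ d → (coeffPow wCoeffs (2 * N)).getD j 0 = 0)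
    (hN : 3 ≤ N) :
    ∃ W : ℂ → ℂ, Continuous W ∧ ∀ u,
      ∑ ν ∈ Finset.range 13, wF ν (thetaLead u) ^ N + wInf (thetaLead u) ^ N =
        13 * ((coeffPow wCoeffs (2 * N)).getD d 0 : ℂ) * u ^ d + u ^ 15 * W u := by
  obtain ⟨V, hV, hsum⟩ := (hasJet_coeffSum_pow wCoeffs (2 * N)).sum_rotate hlen hd had h
  refine ⟨fun u => V u + 13 ^ N * u ^ (6 * N - 15), by fun_prop, fun u => ?_⟩
  have hinf : wInf (thetaLead u) ^ N = u ^ 15 * (13 ^ N * u ^ (6 * N - 15)) := by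
    rw [mul_left_comm, ← pow_add, Nat.add_sub_cancel' (by omega), pow_mul, ← mul_pow]
    simp only [wInf, AA0, thetaLead, Matrix.cons_val]
    ring
  rw [mul_add, ← add_assoc, ← hsum, ← hinf]
  congr 1
  refine Finset.sum_congr rfl fun ν _ => ?_
  rw [wF_thetaLead, wF_zero_thetaLead, mul_pow, ← pow_mul, ← pow_mul, ← pow_mul _ 2]

theorem sum_dF_pow_thetaLead (N : ℕ) {d : ℕ} (hd : d < 15) (had : 13 ∣ 30 * N + d)
    (hlen : (coeffPow dCoeffs N).length ≤ 15)
    (h : ∀ j < 15, 13 ∣ 30 * N + j → j ≠ d → (coeffPow dCoeffs N).getD j 0 = 0)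
    (hN : 1 ≤ N) :
    ∃ W : ℂ → ℂ, Continuous W ∧ ∀ u,
      ∑ ν ∈ Finset.range 13, dF ν (thetaLead u) ^ N + dInf (thetaLead u) ^ N =
        13 * ((coeffPow dCoeffs N).getD d 0 : ℂ) * u ^ d + u ^ 15 * W u := by
  obtain ⟨V, hV, hsum⟩ := (hasJet_coeffSum_pow dCoeffs N).sum_rotate hlen hd had h
  refine ⟨fun u => V u + (169 * (u ^ 26 + 1)) ^ N * u ^ (22 * N - 15), by fun_prop, fun u => ?_⟩
  have hinf : dInf (thetaLead u) ^ N =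
      u ^ 15 * ((169 * (u ^ 26 + 1)) ^ N * u ^ (22 * N - 15)) := by
    rw [mul_left_comm, ← pow_add, Nat.add_sub_cancel' (by omega), pow_mul, ← mul_pow]
    simp only [dInf, GG0, DD0, DDinf, thetaLead, Matrix.cons_val]
    ring
  rw [mul_add, ← add_assoc, ← hsum, ← hinf]
  congr 1
  refine Finset.sum_congr rfl fun ν _ => ?_
  rw [dF_thetaLead, dF_zero_thetaLead, mul_pow, ← pow_mul]

/-! ### Behaviour at the cusp -/

/-- The local parameter at the cusp of level `13`. -/
def localParam (z : ℂ) : ℂ := exp (2 * Real.pi * I * z / 13)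

/-- The theta constants, rescaled so that they extend to power series in `localParam`. -/
def cuspVec (z : ℂ) : Fin 6 → ℂ := exp (-(2 * Real.pi * I * z / 104)) • AV z

theorem norm_localParam (z : ℂ) : ‖localParam z‖ = Real.exp (-(2 * Real.pi * z.im / 13)) := by
  rw [localParam, norm_exp]
  congr 1
  rw [show 2 * (Real.pi : ℂ) * I * z / 13 = ((2 * Real.pi / 13 : ℝ) : ℂ) * (I * z) by
    push_cast; ring, re_ofReal_mul, I_mul_re]
  ring

theorem tendsto_localParam :
    Filter.Tendsto (fun z : UpperHalfPlane => localParam z) UpperHalfPlane.atImInfty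
      (nhds 0) := by
  have h := UpperHalfPlane.qParam_tendsto_atImInfty (h := 13) (by norm_num)
  simpa [Function.Periodic.qParam, localParam] using h

theorem summable_two_inv_pow_natAbs : Summable fun n : ℤ => (1 / 2 : ℝ) ^ n.natAbs := by
  refine Summable.of_nat_of_neg ?_ ?_ <;> simpa using summable_geometric_two

/-- Each theta constant agrees with its leading term up to order `localParam ^ 15`. -/
theorem norm_th13_sub_le {l : ℤ} {c : ℚ} {e : ℕ} (hl : 0 ≤ l) (hc : 104 * c = l ^ 2)
    (he : 8 * (e : ℤ) + 1 = l ^ 2) (hl' : l ≤ 9 ∨ l = 11) {z : ℂ}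
    (hu : ‖localParam z‖ ≤ 1 / 2) :
    ‖exp (-(2 * Real.pi * I * z / 104)) * th13 c l z - localParam z ^ e‖ ≤
      (∑' n : ℤ, (1 / 2 : ℝ) ^ n.natAbs) * ‖localParam z‖ ^ 15 := by
  have hc' : (c : ℂ) = (l : ℂ) ^ 2 / 104 := by
    rw [eq_div_iff (by norm_num), mul_comm]
    exact_mod_cast hc
  have he' : (l : ℂ) ^ 2 = 8 * (e : ℂ) + 1 := by exact_mod_cast he.symm
  have hterm (n : ℤ) : exp (-(2 * Real.pi * I * z / 104)) * (exp (2 * Real.pi * I * (c : ℂ) * z) *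
      ((-1 : ℂ) ^ n * exp (2 * Real.pi * I * (((13 * n ^ 2 + l * n : ℤ) : ℂ) / 2) * z))) =
      (-1 : ℂ) ^ n * exp ((e + 13 * (13 * n ^ 2 + l * n) / 2 : ℝ) * (2 * Real.pi * I * z / 13)) := by
    rw [mul_left_comm _ ((-1 : ℂ) ^ n), mul_left_comm _ ((-1 : ℂ) ^ n), ← exp_add, ← exp_add, hc', he']
    push_cast
    ring_nf
  set f : ℤ → ℂ := fun n =>
    (-1 : ℂ) ^ n * exp ((e + 13 * (13 * n ^ 2 + l * n) / 2 : ℝ) * (2 * Real.pi * I * z / 13)) with hf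
  have hnorm (n : ℤ) :
      ‖f n‖ = Real.exp ((e + 13 * (13 * n ^ 2 + l * n) / 2) * -(2 * Real.pi * z.im / 13)) := by
    rw [hf, norm_mul, norm_zpow, norm_neg, norm_one, one_zpow, one_mul, norm_exp, re_ofReal_mul]
    congr 2
    rw [show 2 * (Real.pi : ℂ) * I * z / 13 = ((2 * Real.pi / 13 : ℝ) : ℂ) * (I * z) by
      push_cast; ring, re_ofReal_mul, I_mul_re]
    ring
  have him : -(2 * Real.pi * z.im / 13) ≤ 0 := by
    rw [← Real.exp_le_one_iff, ← norm_localParam]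
    linarith
  have hexp (n : ℤ) (hn : n ≠ 0) :
      (15 + n.natAbs : ℝ) ≤ e + 13 * (13 * n ^ 2 + l * n) / 2 := by
    have key : 8 * (15 + (n.natAbs : ℤ)) ≤ 8 * e + 52 * (13 * n ^ 2 + l * n) := by
      rw [Int.natCast_natAbs, eq_sub_of_add_eq he]
      rcases hl' with h | rfl
      · rcases lt_or_gt_of_ne hn with h0 | h0
        · rw [abs_of_neg h0]; nlinarith
        · rw [abs_of_pos h0]; nlinarith
      · rcases lt_or_gt_of_ne hn with h0 | h0
        · rw [abs_of_neg h0]; nlinarith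
        · rw [abs_of_pos h0]; nlinarith
    have h := (Int.cast_le (R := ℝ)).2 key
    push_cast at h
    rw [Nat.cast_natAbs, Int.cast_abs]
    linarith
  have hbound (n : ℤ) (hn : n ≠ 0) : ‖f n‖ ≤ (1 / 2) ^ n.natAbs * ‖localParam z‖ ^ 15 := by
    calc ‖f n‖ ≤ Real.exp ((15 + n.natAbs : ℕ) * -(2 * Real.pi * z.im / 13)) := by
          rw [hnorm]
          refine Real.exp_le_exp.2 (mul_le_mul_of_nonpos_right ?_ him)
          exact_mod_cast hexp n hn
      _ = ‖localParam z‖ ^ n.natAbs * ‖localParam z‖ ^ 15 := by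
          rw [Real.exp_nat_mul, ← norm_localParam, add_comm, pow_add]
      _ ≤ _ := by gcongr
  have hsum : Summable f := by
    refine Summable.of_norm_bounded_eventually (summable_two_inv_pow_natAbs.mul_right (‖localParam z‖ ^ 15))
      (Filter.eventually_cofinite.2 (Set.Finite.subset (Set.finite_singleton 0) fun n hn => ?_))
    by_contra h
    exact hn (hbound n h)
  have hzero : f 0 = localParam z ^ e := by
    rw [localParam, ← exp_nat_mul]
    simp [hf]
  rw [th13, ← tsum_mul_left, ← tsum_mul_left, tsum_congr hterm, hsum.tsum_eq_add_tsum_ite 0, hzero,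
    add_sub_cancel_left]
  refine tsum_of_norm_bounded (summable_two_inv_pow_natAbs.hasSum.mul_right _) fun n => ?_
  split_ifs with h
  · rw [norm_zero]; positivity
  · exact hbound n h

open Filter Topology Asymptotics UpperHalfPlane in
theorem cuspVec_sub_thetaLead_isBigO :
    (fun z : ℍ => cuspVec z - thetaLead (localParam z)) =O[atImInfty]
      fun z : ℍ => localParam z ^ 15 := by
  refine .of_bound (∑' n : ℤ, (1 / 2 : ℝ) ^ n.natAbs) ?_
  have hev : ∀ᶠ z : ℍ in atImInfty, ‖localParam z‖ ≤ 1 / 2 := by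
    filter_upwards [tendsto_localParam.eventually (Metric.ball_mem_nhds 0 one_half_pos)] with z hz
    exact (mem_ball_zero_iff.1 hz).le
  filter_upwards [hev] with z hz
  rw [norm_pow, pi_norm_le_iff_of_nonneg (by positivity)]
  intro i
  fin_cases i
  · exact norm_th13_sub_le (by norm_num) (by norm_num) (by norm_num) (by norm_num) hz
  · exact norm_th13_sub_le (by norm_num) (by norm_num) (by norm_num) (by norm_num) hz
  · exact norm_th13_sub_le (by norm_num) (by norm_num) (by norm_num) (by norm_num) hz
  · have h := norm_th13_sub_le (l := 3) (c := 9 / 104) (e := 1) (by norm_num) (by norm_num)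
      (by norm_num) (by norm_num) hz
    rw [← norm_neg, neg_sub', ← mul_neg, pow_one] at h
    exact h
  · exact norm_th13_sub_le (by norm_num) (by norm_num) (by norm_num) (by norm_num) hz
  · have h := norm_th13_sub_le (l := 1) (c := 1 / 104) (e := 0) (by norm_num) (by norm_num)
      (by norm_num) (by norm_num) hz
    rw [pow_zero] at h
    exact h

open Filter Topology Asymptotics UpperHalfPlane in
theorem tendsto_comp_cuspVec_div {G : (Fin 6 → ℂ) → ℂ} (hG : ContDiff ℂ 1 G) {t : ℂ} {d : ℕ}
    (hd : d < 15)
    (hlead : ∃ W : ℂ → ℂ, Continuous W ∧ ∀ u, G (thetaLead u) = t * u ^ d + u ^ 15 * W u) :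
    Tendsto (fun z : ℍ => G (cuspVec z) / localParam z ^ d) atImInfty (𝓝 t) := by
  obtain ⟨W, hW, hGW⟩ := hlead
  have hu (z : ℍ) : localParam z ≠ 0 := exp_ne_zero _
  have hpow : Tendsto (fun z : ℍ => localParam z ^ (15 - d)) atImInfty (𝓝 0) := by
    simpa [zero_pow (Nat.sub_ne_zero_of_lt hd)] using tendsto_localParam.pow (15 - d)
  have hp : Tendsto (fun z : ℍ => thetaLead (localParam z)) atImInfty (𝓝 (thetaLead 0)) := by
    refine (Continuous.tendsto ?_ 0).comp tendsto_localParam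
    refine continuous_pi fun i => ?_
    fin_cases i <;> simp only [thetaLead] <;> simp <;> fun_prop
  have hb : Tendsto (fun z : ℍ => cuspVec z) atImInfty (𝓝 (thetaLead 0)) := by
    have h0 := cuspVec_sub_thetaLead_isBigO.trans_tendsto
      (by simpa using tendsto_localParam.pow 15)
    simpa using h0.add hp
  have hdiff : (fun z : ℍ => G (cuspVec z) - G (thetaLead (localParam z))) =O[atImInfty]
      fun z : ℍ => localParam z ^ 15 :=
    ((hG.contDiffAt.hasStrictFDerivAt one_ne_zero).isBigO_sub.comp_tendsto
      (hb.prodMk_nhds hp)).trans cuspVec_sub_thetaLead_isBigO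
  have hdiv : Tendsto (fun z : ℍ => (G (cuspVec z) - G (thetaLead (localParam z))) /
      localParam z ^ d) atImInfty (𝓝 0) := by
    refine (hdiff.mul (isBigO_refl (fun z : ℍ => (localParam z ^ d)⁻¹) _)).trans_tendsto ?_
    refine hpow.congr fun z => ?_
    rw [← div_eq_mul_inv, pow_sub₀ _ (hu z) hd.le, div_eq_mul_inv]
  have hmain := (hdiv.add_const t).add (hpow.mul ((hW.tendsto 0).comp tendsto_localParam))
  rw [zero_add, zero_mul, add_zero] at hmain
  refine hmain.congr fun z => ?_
  have := hu z
  rw [hGW, Function.comp_apply, pow_sub₀ _ this hd.le]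
  field_simp
  ring

open Filter Topology in
open UpperHalfPlane (atImInfty qParam_tendsto_atImInfty) in
theorem tendsto_etaProduct :
    Tendsto (fun z : UpperHalfPlane => ∏' n : ℕ, (1 - exp (2 * Real.pi * I * z) ^ (n + 1))) atImInfty
      (𝓝 1) := by
  have h0 : ContinuousAt (fun q : ℂ => ∏' n : ℕ, (1 - q ^ (n + 1))) 0 :=
    (ModularForm.differentiableOn_tprod_one_sub_pow.differentiableAt
      (Metric.ball_mem_nhds 0 one_pos)).continuousAt
  have h := h0.tendsto.comp (qParam_tendsto_atImInfty one_pos)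
  simpa [Function.comp_def, Function.Periodic.qParam] using h

open Filter Topology in
open UpperHalfPlane (atImInfty qParam_tendsto_atImInfty) in
theorem tendsto_comp_AV_div_eta {G : (Fin 6 → ℂ) → ℂ} (hG : ContDiff ℂ 1 G) {t : ℂ} {d h i : ℕ}
    (hd : d < 15)
    (hlead : ∃ W : ℂ → ℂ, Continuous W ∧ ∀ u, G (thetaLead u) = t * u ^ d + u ^ 15 * W u)
    (hsmul : ∀ (c : ℂ) v, G (c • v) = c ^ h * G v) (hi : h + 8 * d = 26 * i) :
    Tendsto (fun z : UpperHalfPlane => G (AV z) / etaF z ^ (6 * i)) atImInfty (𝓝 t) := by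
  have key := (tendsto_comp_cuspVec_div hG hd hlead).div (tendsto_etaProduct.pow (6 * i)) (by simp)
  rw [one_pow, div_one] at key
  refine key.congr fun z => ?_
  have hexp : exp (-(2 * Real.pi * I * z / 104)) ^ h * exp (2 * Real.pi * I * z / 24) ^ (6 * i) =
      localParam z ^ d := by
    have hi' : (h : ℂ) + 8 * d = 26 * i := by exact_mod_cast hi
    rw [localParam, ← exp_nat_mul, ← exp_nat_mul, ← exp_nat_mul, ← exp_add]
    congr 1
    push_cast
    linear_combination (-(2 * Real.pi * I * z / 104)) * hi'
  have h1 := exp_ne_zero (-(2 * Real.pi * I * z / 104))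
  rw [Pi.div_apply, cuspVec, hsmul, ← hexp, etaF, mul_pow, mul_div_mul_left _ _ (pow_ne_zero _ h1), div_div]

/-! ### The invariants of degrees 32, 42 and 44 -/

theorem etaF_ne_zero {z : ℂ} (hz : 0 < z.im) : etaF z ≠ 0 := by
  rw [etaF_eq_eta]
  exact ModularForm.eta_ne_zero hz

theorem differentiableAt_etaF {z : ℂ} (hz : 0 < z.im) : DifferentiableAt ℂ etaF z := by
  rw [funext etaF_eq_eta]
  exact ModularForm.differentiableAt_eta_of_mem_upperHalfPlaneSet hz

/-- A power sum of theta constants of weight `3 * i + k`, with leading term matching that of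
`η ^ (6 * i)`, is a multiple of `η ^ (6 * i)` times an Eisenstein series. -/
theorem comp_AV_eq_eta_mul_Eis {m N d i k : ℕ} {Q : (Fin 6 → ℂ) → ℂ} {R : ℕ → (Fin 6 → ℂ) → ℂ}
    (hQ : IsBorelInvariant m (Q ∘ oddVec)) (h₀ : ∀ v, Q (fourierAct v) = 13 ^ m * R 0 v)
    (hR : ∀ ν v, R ν v = R 0 (diagAct (ζ ^ ν) v)) {G : (Fin 6 → ℂ) → ℂ}
    (hGdef : ∀ v, G v = ∑ ν ∈ Finset.range 13, R ν v ^ N + Q v ^ N) (hG : ContDiff ℂ 1 G)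
    (hsmul : ∀ (c : ℂ) v, G (c • v) = c ^ (2 * m * N) * G v) {t c : ℂ} (hct : c * t = 1)
    (hd : d < 15)
    (hlead : ∃ W : ℂ → ℂ, Continuous W ∧ ∀ u, G (thetaLead u) = t * u ^ d + u ^ 15 * W u)
    (hi : 2 * m * N + 8 * d = 26 * i) (hmN : m * N = 3 * i + k) (h4 : 4 ∣ 2 * i + k) (hk : 3 ≤ k)
    (hk₂ : Even k) (hk₁₂ : k < 12) {z : ℂ} (hz : 0 < z.im) :
    c * G (AV z) = etaF z ^ (6 * i) * Eis k z := by
  have horbit (z : ℂ) : orbitSum m (Q ∘ oddVec) N (thetaFun z) = 13 ^ (m * N) * G (AV z) := by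
    rw [orbitSum_comp_oddVec h₀ hR N (odd_thetaFun z), oddVec_thetaFun, hGdef]
  have h13 : (13 : ℂ) ^ (m * N) ≠ 0 := pow_ne_zero _ (by norm_num)
  have hI : I ^ (m * N) = I ^ i := by
    obtain ⟨s, hs⟩ := h4
    rw [hmN, show 3 * i + k = 4 * s + i by omega, pow_add, pow_mul, I_pow_four, one_pow, one_mul]
  have hGT (z : ℂ) : G (AV (z + 1)) = I ^ i * G (AV z) := by
    have := hQ.orbitSum_thetaFun_add_one N z
    rw [horbit, horbit, mul_left_comm] at this
    rw [mul_left_cancel₀ h13 this, hI]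
  have hGS {z : ℂ} (hz : 0 < z.im) : G (AV (-1 / z)) = I ^ i * z ^ (3 * i + k) * G (AV z) := by
    have := hQ.orbitSum_thetaFun_neg_inv N hz
    rw [horbit, horbit, mul_left_comm] at this
    rw [mul_left_cancel₀ h13 this, mul_pow, hI, hmN]
  have hIi : I ^ i ≠ 0 := pow_ne_zero _ I_ne_zero
  have key : c * (G (AV z) / etaF z ^ (6 * i)) = Eis k z := by
    refine eq_Eis_of_tendsto (f := fun z => c * (G (AV z) / etaF z ^ (6 * i))) hk hk₂ hk₁₂
      (fun z hz => ?_) (fun z hz => ?_) (fun z hz => ?_) ?_ hz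
    · refine (DifferentiableAt.div ?_ ((differentiableAt_etaF hz).pow _)
        (pow_ne_zero _ (etaF_ne_zero hz))).const_mul c
      exact (hG.differentiable one_ne_zero _).comp z (differentiableAt_AV hz)
    · rw [pow_mul, eta_add_one_pow_six, mul_pow, hGT, mul_div_mul_left _ _ hIi, pow_mul]
    · have hz₀ : z ≠ 0 := by rintro rfl; simp at hz
      have hη := etaF_ne_zero hz
      rw [pow_mul, eta_neg_inv_pow_six hz, hGS hz, mul_pow, mul_pow, ← pow_mul, ← pow_mul, pow_add]
      field_simp
    · rw [← hct]
      exact (tendsto_comp_AV_div_eta hG hd hlead hsmul hi).const_mul c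
  rw [← key]
  have := etaF_ne_zero hz
  field_simp

theorem contDiff_sum_wF_pow (N : ℕ) :
    ContDiff ℂ 1 fun v => ∑ ν ∈ Finset.range 13, wF ν v ^ N + wInf v ^ N := by
  unfold wF wInf AA0 AA1 AA2 AA3 AA4 AA5 AA6
  fun_prop

theorem contDiff_sum_dF_pow (N : ℕ) :
    ContDiff ℂ 1 fun v => ∑ ν ∈ Finset.range 13, dF ν v ^ N + dInf v ^ N := by
  have h0 : ContDiff ℂ 1 DD0 := by unfold DD0; fun_prop
  have h1 : ContDiff ℂ 1 DD1 := by unfold DD1; fun_prop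
  have h2 : ContDiff ℂ 1 DD2 := by unfold DD2; fun_prop
  have h3 : ContDiff ℂ 1 DD3 := by unfold DD3; fun_prop
  have h4 : ContDiff ℂ 1 DD4 := by unfold DD4; fun_prop
  have h5 : ContDiff ℂ 1 DD5 := by unfold DD5; fun_prop
  have h6 : ContDiff ℂ 1 DD6 := by unfold DD6; fun_prop
  have h7 : ContDiff ℂ 1 DD7 := by unfold DD7; fun_prop
  have h8 : ContDiff ℂ 1 DD8 := by unfold DD8; fun_prop
  have h9 : ContDiff ℂ 1 DD9 := by unfold DD9; fun_prop
  have h10 : ContDiff ℂ 1 DD10 := by unfold DD10; fun_prop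
  have h11 : ContDiff ℂ 1 DD11 := by unfold DD11; fun_prop
  have h12 : ContDiff ℂ 1 DD12 := by unfold DD12; fun_prop
  have hinf : ContDiff ℂ 1 DDinf := by unfold DDinf; fun_prop
  unfold dF dInf GG0 GG1 GG2 GG3 GG4 GG5 GG6 GG7 GG8 GG9 GG10 GG11 GG12
  fun_prop

theorem sum_wF_pow_smul (N : ℕ) (c : ℂ) (v : Fin 6 → ℂ) :
    ∑ ν ∈ Finset.range 13, wF ν (c • v) ^ N + wInf (c • v) ^ N =
      c ^ (2 * 2 * N) * (∑ ν ∈ Finset.range 13, wF ν v ^ N + wInf v ^ N) := by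
  simp only [wF_smul, wInf_smul, mul_pow, ← pow_mul, ← Finset.mul_sum, ← mul_add]

theorem sum_dF_pow_smul (N : ℕ) (c : ℂ) (v : Fin 6 → ℂ) :
    ∑ ν ∈ Finset.range 13, dF ν (c • v) ^ N + dInf (c • v) ^ N =
      c ^ (2 * 3 * N) * (∑ ν ∈ Finset.range 13, dF ν v ^ N + dInf v ^ N) := by
  simp only [dF_smul, dInf_smul, mul_pow, ← pow_mul, ← Finset.mul_sum, ← mul_add]

theorem xV_eq_smul (z : ℂ) : xV z = etaF z • AV z := rfl

theorem Phi32_AV {z : ℂ} (hz : 0 < z.im) : Phi32 (AV z) = etaF z ^ 24 * Eis 4 z := by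
  have hcoeff : (coeffPow wCoeffs (2 * 8)).getD 9 0 = -1840 := by decide +kernel
  have hlead := sum_wF_pow_thetaLead 8 (d := 9) (by norm_num) (by norm_num) (by decide +kernel)
    (by decide +kernel) (by norm_num)
  rw [hcoeff] at hlead
  exact comp_AV_eq_eta_mul_Eis (i := 4) isBorelInvariant_wInf wInf_fourierAct wF_eq_wF_zero
    (fun _ => rfl) (contDiff_sum_wF_pow 8) (sum_wF_pow_smul 8) (by norm_num) (by norm_num) hlead
    (by norm_num) (by norm_num) (by norm_num) (by norm_num) (by decide) (by norm_num) hz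

theorem Phi42_AV {z : ℂ} (hz : 0 < z.im) : Phi42 (AV z) = etaF z ^ 30 * Eis 6 z := by
  have hcoeff : (coeffPow dCoeffs 7).getD 11 0 = 226842 := by decide +kernel
  have hlead := sum_dF_pow_thetaLead 7 (d := 11) (by norm_num) (by norm_num) (by decide +kernel)
    (by decide +kernel) (by norm_num)
  rw [hcoeff] at hlead
  exact comp_AV_eq_eta_mul_Eis (i := 5) isBorelInvariant_dInf dInf_fourierAct dF_eq_dF_zero
    (fun _ => rfl) (contDiff_sum_dF_pow 7) (sum_dF_pow_smul 7) (by norm_num) (by norm_num) hlead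
    (by norm_num) (by norm_num) (by norm_num) (by norm_num) (by decide) (by norm_num) hz

theorem Phi44_AV {z : ℂ} (hz : 0 < z.im) : Phi44 (AV z) = etaF z ^ 36 * Eis 4 z := by
  have hcoeff : (coeffPow wCoeffs (2 * 11)).getD 14 0 = 146905 := by decide +kernel
  have hlead := sum_wF_pow_thetaLead 11 (d := 14) (by norm_num) (by norm_num) (by decide +kernel)
    (by decide +kernel) (by norm_num)
  rw [hcoeff] at hlead
  exact comp_AV_eq_eta_mul_Eis (i := 6) isBorelInvariant_wInf wInf_fourierAct wF_eq_wF_zero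
    (fun _ => rfl) (contDiff_sum_wF_pow 11) (sum_wF_pow_smul 11) (by norm_num) (by norm_num) hlead
    (by norm_num) (by norm_num) (by norm_num) (by norm_num) (by decide) (by norm_num) hz

theorem stmt15 (z : ℂ) (hz : 0 < z.im) :
    Phi32 (xV z) = (etaF z) ^ 8 * (Δfun z) ^ 2 * Eis 4 z ∧
    Phi42 (xV z) = (Δfun z) ^ 3 * Eis 6 z ∧
    Phi44 (xV z) = (etaF z) ^ 8 * (Δfun z) ^ 3 * Eis 4 z := by
  refine ⟨?_, ?_, ?_⟩
  · have h : Phi32 (xV z) = etaF z ^ 32 * Phi32 (AV z) := by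
      rw [xV_eq_smul, Phi32, Phi32, sum_wF_pow_smul, mul_left_comm]
    rw [h, Phi32_AV hz, Δfun]
    ring
  · have h : Phi42 (xV z) = etaF z ^ 42 * Phi42 (AV z) := by
      rw [xV_eq_smul, Phi42, Phi42, sum_dF_pow_smul, mul_left_comm]
    rw [h, Phi42_AV hz, Δfun]
    ring
  · have h : Phi44 (xV z) = etaF z ^ 44 * Phi44 (AV z) := by
      rw [xV_eq_smul, Phi44, Phi44, sum_wF_pow_smul, mul_left_comm]
    rw [h, Phi44_AV hz, Δfun]
    ring
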